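/- arXiv:2006.01566 — 9 statements merged into one kernel-verified Lean document; each statement's English description precedes it below -/
import Mathlib

section
/- Let μ ∈ ℝ, r > 0, and let g be holomorphic on the open disc B(μ, r) ⊂ ℂ with M = sup_{w ∈ B(μ,r)} |Im g(w)| < ∞. Then for every ν ∈ (−r, r), the derivative at ν of the function t ↦ Im g(μ + it), which equals Re g'(μ + iν), satisfies |Re g'(μ + iν)| ≤ 2rM/(r − |ν|)². If moreover M < r(1−φ)²/2 for some φ ∈ (0,1), then |Re g'(μ + iν)| < 1 for all ν ∈ ℝ with |ν| ≤ φ r. -/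
open MeasureTheory

/-- Schwarz lemma for maps into a half-plane: a holomorphic function on a disc with `Im g < B` has
derivative at most `2 (B - Im g(c)) / R` at the center. -/
theorem norm_deriv_le_of_im_lt {g : ℂ → ℂ} {c : ℂ} {R B : ℝ} (hR : 0 < R)
    (hg : DifferentiableOn ℂ g (Metric.ball c R))
    (hB : ∀ z ∈ Metric.ball c R, (g z).im < B) :
    ‖deriv g c‖ ≤ 2 * (B - (g c).im) / R := by
  have hc : c ∈ Metric.ball c R := Metric.mem_ball_self hR
  have hA : 0 < B - (g c).im := sub_pos.2 (hB c hc)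
  set A := B - (g c).im with hA_def
  set d : ℂ := 2 * A * Complex.I
  have hd_norm : ‖d‖ = 2 * A := by simp [d, abs_of_pos hA]
  have hd : d ≠ 0 := norm_pos_iff.1 (by rw [hd_norm]; positivity)
  have hlt : ∀ z ∈ Metric.ball c R, ‖g z - g c‖ < ‖g z - g c - d‖ := by
    intro z hz
    have him := hB z hz
    rw [← sq_lt_sq₀ (norm_nonneg _) (norm_nonneg _), Complex.sq_norm, Complex.sq_norm,
      Complex.normSq_apply, Complex.normSq_apply]
    simp [d]
    nlinarith
  have hne : ∀ z ∈ Metric.ball c R, g z - g c - d ≠ 0 := fun z hz =>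
    norm_pos_iff.1 ((norm_nonneg _).trans_lt (hlt z hz))
  let F : ℂ → ℂ := fun z => (g z - g c) / (g z - g c - d)
  have hF : DifferentiableOn ℂ F (Metric.ball c R) :=
    (hg.sub_const _).div ((hg.sub_const _).sub_const _) hne
  have hmaps : Set.MapsTo F (Metric.ball c R) (Metric.ball (F c) 1) := by
    intro z hz
    simpa [F, div_lt_one (norm_pos_iff.2 (hne z hz))] using hlt z hz
  have hgc : HasDerivAt g (deriv g c) c :=
    (hg.differentiableAt (Metric.isOpen_ball.mem_nhds hc)).hasDerivAt
  have hFc : deriv F c = -(deriv g c / d) := by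
    have h := ((hgc.sub_const (g c)).div ((hgc.sub_const (g c)).sub_const d) (hne c hc)).deriv
    refine h.trans ?_
    simp only [sub_self, zero_sub, zero_mul, sub_zero]
    field_simp
  have h := Complex.norm_deriv_le_div_of_mapsTo_ball hF
    (hmaps.mono_right Metric.ball_subset_closedBall) hR
  rw [hFc, norm_neg, norm_div, hd_norm, div_le_div_iff₀ (by positivity) hR] at h
  rw [le_div_iff₀ hR]
  linarith

/-- A holomorphic function with `|Im g| ≤ M` on a disc of radius `R` has derivative at most
`2 M / R` at the center. -/
theorem norm_deriv_le_of_abs_im_le {g : ℂ → ℂ} {c : ℂ} {R M : ℝ} (hR : 0 < R)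
    (hg : DifferentiableOn ℂ g (Metric.ball c R))
    (hM : ∀ z ∈ Metric.ball c R, |(g z).im| ≤ M) :
    ‖deriv g c‖ ≤ 2 * M / R := by
  rw [le_div_iff₀ hR]
  refine le_of_forall_pos_le_add fun ε hε => ?_
  have h₁ := norm_deriv_le_of_im_lt (B := M + ε / 2) hR hg fun z hz => by
    linarith [(abs_le.1 (hM z hz)).2]
  have h₂ := norm_deriv_le_of_im_lt (g := -g) (B := M + ε / 2) hR hg.neg fun z hz => by
    simp only [Pi.neg_apply, Complex.neg_im]
    linarith [(abs_le.1 (hM z hz)).1]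
  rw [deriv.neg, norm_neg, Pi.neg_apply, Complex.neg_im] at h₂
  rw [le_div_iff₀ hR] at h₁ h₂
  linarith

theorem poisson_vertical_derivative_estimate
    (μ r : ℝ) (hr : 0 < r) (g : ℂ → ℂ)
    (hg : DifferentiableOn ℂ g (Metric.ball (μ : ℂ) r))
    (M : ℝ) (hM : ∀ w ∈ Metric.ball (μ : ℂ) r, |(g w).im| ≤ M)
    (φ : ℝ) (hφ : φ ∈ Set.Ioo (0:ℝ) 1) :
    (∀ ν : ℝ, |ν| < r →
      HasDerivAt (fun t : ℝ => (g (↑μ + ↑t * Complex.I)).im)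
        ((deriv g (↑μ + ↑ν * Complex.I)).re) ν ∧
      |(deriv g (↑μ + ↑ν * Complex.I)).re| ≤ 2 * r * M / (r - |ν|) ^ 2) ∧
    (M < r * (1 - φ) ^ 2 / 2 →
      ∀ ν : ℝ, |ν| ≤ φ * r → |(deriv g (↑μ + ↑ν * Complex.I)).re| < 1) := by
  have hM0 : 0 ≤ M := (abs_nonneg _).trans (hM μ (Metric.mem_ball_self hr))
  have bound : ∀ ν : ℝ, |ν| < r →
      |(deriv g (↑μ + ↑ν * Complex.I)).re| ≤ 2 * r * M / (r - |ν|) ^ 2 := by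
    intro ν hν
    have hR : 0 < r - |ν| := sub_pos.2 hν
    have hsub : Metric.ball (↑μ + ↑ν * Complex.I) (r - |ν|) ⊆ Metric.ball (μ : ℂ) r :=
      Metric.ball_subset_ball' (by simp [dist_eq_norm])
    refine (Complex.abs_re_le_norm _).trans <|
      (norm_deriv_le_of_abs_im_le hR (hg.mono hsub) fun z hz => hM z (hsub hz)).trans ?_
    rw [div_le_div_iff₀ hR (by positivity)]
    have : 0 ≤ 2 * M * (r - |ν|) * |ν| := by positivity
    nlinarith
  refine ⟨fun ν hν => ⟨?_, bound ν hν⟩, fun hMφ ν hν => ?_⟩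
  · have hmem : (μ : ℂ) + ν * Complex.I ∈ Metric.ball (μ : ℂ) r := by
      simpa [dist_eq_norm] using hν
    have hgν := (hg.differentiableAt (Metric.isOpen_ball.mem_nhds hmem)).hasDerivAt
    have hline : HasDerivAt (fun t : ℝ => (μ : ℂ) + t * Complex.I) Complex.I ν := by
      simpa using (Complex.ofRealCLM.hasDerivAt.mul_const Complex.I).const_add (μ : ℂ)
    have h := Complex.imCLM.hasFDerivAt.comp_hasDerivAt ν (hgν.comp ν hline)
    simpa [Function.comp_def] using h
  · have hφr : φ * r < r := by nlinarith [hφ.2]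
    refine (bound ν (hν.trans_lt hφr)).trans_lt ?_
    have hR : 0 < r - |ν| := sub_pos.2 (hν.trans_lt hφr)
    rw [div_lt_one (by positivity)]
    calc 2 * r * M < (r - φ * r) ^ 2 := by nlinarith
      _ ≤ (r - |ν|) ^ 2 := pow_le_pow_left₀ (by linarith) (by linarith) 2
end

section
/- Let a < b be reals, r > 0 with b > a + 2r, and φ ∈ (0,1). Let g be holomorphic on the open rectangle R = {w ∈ ℂ : a < Re w < b, |Im w| < r}, suppose Im g(μ) = 0 for every μ ∈ (a,b), and suppose sup_{w ∈ R} |Im g(w)| ≤ r(1−φ)²/2. Then for every μ ∈ (a+r, b−r) and every real ν with 0 < |ν| ≤ φ r one has Im g(μ + iν) ≠ ν. -/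
open MeasureTheory

/-- A Borel–Carathéodory bound: if `Im g ≤ M` on `ball c R` and `g c` is real, then `|Im g|` grows at
most linearly away from `c`. -/
theorem abs_im_le_of_im_le {g : ℂ → ℂ} {c z : ℂ} {M R : ℝ} (hM : 0 < M)
    (hg : DifferentiableOn ℂ g (Metric.ball c R)) (hgM : ∀ w ∈ Metric.ball c R, (g w).im ≤ M)
    (hc : (g c).im = 0) (hz : ‖z‖ < R) :
    |(g (c + z)).im| ≤ 2 * M * ‖z‖ / (R - ‖z‖) := by
  have hmaps : Set.MapsTo (fun w : ℂ ↦ c + w) (Metric.ball 0 R) (Metric.ball c R) := by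
    intro w hw
    simpa using hw
  have hdiff : DifferentiableOn ℂ (fun w ↦ -Complex.I * (g (c + w) - g c)) (Metric.ball 0 R) :=
    ((hg.comp (by fun_prop) hmaps).sub_const _).const_mul _
  have hre : Set.MapsTo (fun w ↦ -Complex.I * (g (c + w) - g c)) (Metric.ball 0 R)
      {w | w.re ≤ M} := by
    intro w hw
    simpa [hc] using hgM _ (hmaps hw)
  have hnorm := Complex.borelCaratheodory_zero hM hdiff hre ((norm_nonneg z).trans_lt hz)
    (by simpa using hz) (by simp)
  refine le_trans ?_ hnorm
  simpa [hc] using Complex.abs_im_le_norm (g (c + z) - g c)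

theorem eta_nonvanishing_in_rectangle
    (a b r φ : ℝ) (hr : 0 < r) (hb : a + 2 * r < b) (hφ : φ ∈ Set.Ioo (0:ℝ) 1)
    (g : ℂ → ℂ)
    (hg : DifferentiableOn ℂ g {w : ℂ | a < w.re ∧ w.re < b ∧ |w.im| < r})
    (hreal : ∀ μ : ℝ, a < μ → μ < b → (g μ).im = 0)
    (hbound : ∀ w : ℂ, a < w.re → w.re < b → |w.im| < r →
      |(g w).im| ≤ r * (1 - φ) ^ 2 / 2) :
    ∀ μ : ℝ, a + r < μ → μ < b - r → ∀ ν : ℝ, ν ≠ 0 → |ν| ≤ φ * r →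
      (g (↑μ + ↑ν * Complex.I)).im ≠ ν := by
  obtain ⟨hφ0, hφ1⟩ := hφ
  intro μ hμa hμb ν hν hνr heq
  have hφ' : 0 < 1 - φ := by linarith
  have hνpos : 0 < |ν| := abs_pos.mpr hν
  have hball : ∀ w ∈ Metric.ball (μ : ℂ) r, a < w.re ∧ w.re < b ∧ |w.im| < r := by
    intro w hw
    rw [mem_ball_iff_norm] at hw
    have hre : |w.re - μ| < r := by simpa using (Complex.abs_re_le_norm (w - μ)).trans_lt hw
    have him : |w.im| < r := by simpa using (Complex.abs_im_le_norm (w - μ)).trans_lt hw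
    rw [abs_lt] at hre
    exact ⟨by linarith, by linarith, him⟩
  have hnorm : ‖(ν : ℂ) * Complex.I‖ = |ν| := by simp
  have hgap : r * (1 - φ) ≤ r - |ν| := by linarith
  have hlinear : |(g (μ + ν * Complex.I)).im| ≤
      2 * (r * (1 - φ) ^ 2 / 2) * |ν| / (r - |ν|) := by
    rw [← hnorm]
    refine abs_im_le_of_im_le (by positivity) (hg.mono hball) (fun w hw ↦ ?_)
      (hreal μ (by linarith) (by linarith)) (by rw [hnorm]; nlinarith)
    obtain ⟨h₁, h₂, h₃⟩ := hball w hw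
    exact (le_abs_self _).trans (hbound w h₁ h₂ h₃)
  rw [heq, le_div_iff₀ ((by positivity : 0 < r * (1 - φ)).trans_le hgap)] at hlinear
  have hle : r * (1 - φ) ≤ r * (1 - φ) ^ 2 :=
    hgap.trans (le_of_mul_le_mul_left (by linarith) hνpos)
  have hpos : 0 < r * (1 - φ) * φ := by positivity
  linarith
end

section
/- Let D ⊆ ℂ be open and let V : [0,1] × D → ℂ be such that for each λ ∈ D the function x ↦ V(x,λ) is continuous, and for each x ∈ [0,1] the function λ ↦ V(x,λ) is holomorphic on D and real-valued at real points of D. Let a ∈ ℝ and suppose ξ = sup{ |Im V(x,λ)| : x ∈ [0,1], λ ∈ D, Re λ > a } < ∞, and that the half-strip (a,∞) × (−ρ, ρ) is contained in D, where ρ = ξ/(2−√3). If λ ∈ D with Re λ > a + ρ is an eigenvalue of the quasi-periodic problem with some parameter k ∈ [0,2π), or a Dirichlet eigenvalue, or a Neumann eigenvalue, for the potential x ↦ V(x,λ), then λ is real (and hence λ > a + ρ). In particular, if a full half-plane {Re λ > a} is contained in D and the imaginary part of V is bounded there, the spectra of the quasi-periodic, Dirichlet and Neumann problems in the half-plane {Re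 λ > a + ρ} are real. -/
open MeasureTheory

/-- `lam` is an eigenvalue of the quasi-periodic problem with parameter `k` for the
potential `W` on `[0,1]`: there is a nontrivial solution `y` of `-y'' + W y = lam y`
with `y(1) = e^{ik} y(0)`, `y'(1) = e^{ik} y'(0)`. -/
def HillQPEigen (W : ℝ → ℂ) (k : ℝ) (lam : ℂ) : Prop :=
  ∃ y yd : ℝ → ℂ,
    (∃ x ∈ Set.Icc (0:ℝ) 1, y x ≠ 0) ∧
    (∀ x ∈ Set.Icc (0:ℝ) 1, HasDerivWithinAt y (yd x) (Set.Icc (0:ℝ) 1) x) ∧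
    (∀ x ∈ Set.Icc (0:ℝ) 1,
      HasDerivWithinAt yd (W x * y x - lam * y x) (Set.Icc (0:ℝ) 1) x) ∧
    y 1 = Complex.exp (Complex.I * k) * y 0 ∧
    yd 1 = Complex.exp (Complex.I * k) * yd 0

/-- `lam` is a Dirichlet eigenvalue for the potential `W` on `[0,1]`. -/
def HillDirichletEigen (W : ℝ → ℂ) (lam : ℂ) : Prop :=
  ∃ y yd : ℝ → ℂ,
    (∃ x ∈ Set.Icc (0:ℝ) 1, y x ≠ 0) ∧
    (∀ x ∈ Set.Icc (0:ℝ) 1, HasDerivWithinAt y (yd x) (Set.Icc (0:ℝ) 1) x) ∧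
    (∀ x ∈ Set.Icc (0:ℝ) 1,
      HasDerivWithinAt yd (W x * y x - lam * y x) (Set.Icc (0:ℝ) 1) x) ∧
    y 0 = 0 ∧ y 1 = 0

/-- `lam` is a Neumann eigenvalue for the potential `W` on `[0,1]`. -/
def HillNeumannEigen (W : ℝ → ℂ) (lam : ℂ) : Prop :=
  ∃ y yd : ℝ → ℂ,
    (∃ x ∈ Set.Icc (0:ℝ) 1, y x ≠ 0) ∧
    (∀ x ∈ Set.Icc (0:ℝ) 1, HasDerivWithinAt y (yd x) (Set.Icc (0:ℝ) 1) x) ∧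
    (∀ x ∈ Set.Icc (0:ℝ) 1,
      HasDerivWithinAt yd (W x * y x - lam * y x) (Set.Icc (0:ℝ) 1) x) ∧
    yd 0 = 0 ∧ yd 1 = 0

open Complex in
/-- A holomorphic function on a disc with real centre `c` which is real at `c` and whose imaginary
part is at most `M` satisfies a Borel–Carathéodory bound for its imaginary part. -/
lemma abs_im_le_of_im_le_on_ball {f : ℂ → ℂ} {c z : ℂ} {M R : ℝ} (hM : 0 < M)
    (hf : DifferentiableOn ℂ f (Metric.ball c R))
    (hfM : ∀ w ∈ Metric.ball c R, (f w).im ≤ M) (hc : (f c).im = 0)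
    (hz : z ∈ Metric.ball c R) :
    |(f z).im| ≤ 2 * M * ‖z - c‖ / (R - ‖z - c‖) := by
  have hmaps : Set.MapsTo (fun w : ℂ => w + c) (Metric.ball 0 R) (Metric.ball c R) := by
    intro w hw
    simpa [dist_eq_norm] using hw
  have hzR : ‖z - c‖ < R := by simpa [dist_eq_norm] using hz
  have h := Complex.borelCaratheodory_zero (f := fun w => -I * (f (w + c) - f c)) (z := z - c) hM
    (((hf.comp (by fun_prop) hmaps).sub_const _).const_mul _)
    (fun w hw => by simpa [hc] using hfM _ (hmaps hw))
    ((norm_nonneg _).trans_lt hzR) (by simpa using hzR) (by simp)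
  refine le_trans ?_ h
  have := abs_im_le_norm (f z - f c)
  simpa [hc] using this

/-- A function on `[0,1]` with equal end values and nonpositive derivative has zero derivative. -/
lemma deriv_eq_zero_of_nonpos_of_eq_ends {F F' : ℝ → ℝ}
    (hF : ∀ x ∈ Set.Icc (0:ℝ) 1, HasDerivWithinAt F (F' x) (Set.Icc (0:ℝ) 1) x)
    (hF' : ∀ x ∈ Set.Icc (0:ℝ) 1, F' x ≤ 0) (hends : F 1 = F 0) :
    ∀ x ∈ Set.Icc (0:ℝ) 1, F' x = 0 := by
  have hderiv : ∀ x ∈ interior (Set.Icc (0:ℝ) 1), HasDerivAt F (F' x) x := fun x hx =>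
    (hF x (interior_subset hx)).hasDerivAt (mem_interior_iff_mem_nhds.mp hx)
  have hanti : AntitoneOn F (Set.Icc (0:ℝ) 1) :=
    antitoneOn_of_deriv_nonpos (convex_Icc 0 1) (fun x hx => (hF x hx).continuousWithinAt)
      (fun x hx => (hderiv x hx).differentiableAt.differentiableWithinAt)
      (fun x hx => (hderiv x hx).deriv ▸ hF' x (interior_subset hx))
  have hconst : ∀ x ∈ Set.Icc (0:ℝ) 1, F x = F 0 := fun x hx =>
    le_antisymm (hanti (by simp) hx hx.1) (hends ▸ hanti hx (by simp) hx.2)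
  intro x hx
  exact (uniqueDiffOn_Icc zero_lt_one x hx).eq_deriv _ (hF x hx)
    ((hasDerivWithinAt_const x _ (F 0)).congr hconst (hconst x hx))

open ComplexConjugate in
/-- If the imaginary part of the potential is everywhere smaller in modulus than that of `lam`, a
solution of `-y'' + W y = lam y` whose flux `Im (y' conj y)` agrees at both ends vanishes. -/
lemma solution_eq_zero_of_flux_eq {W y yd : ℝ → ℂ} {lam : ℂ}
    (hy : ∀ x ∈ Set.Icc (0:ℝ) 1, HasDerivWithinAt y (yd x) (Set.Icc (0:ℝ) 1) x)
    (hyd : ∀ x ∈ Set.Icc (0:ℝ) 1,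
      HasDerivWithinAt yd (W x * y x - lam * y x) (Set.Icc (0:ℝ) 1) x)
    (hW : ∀ x ∈ Set.Icc (0:ℝ) 1, |(W x).im| < |lam.im|)
    (hflux : (yd 1 * conj (y 1)).im = (yd 0 * conj (y 0)).im) :
    ∀ x ∈ Set.Icc (0:ℝ) 1, y x = 0 := by
  have hF : ∀ x ∈ Set.Icc (0:ℝ) 1, HasDerivWithinAt (fun t => (yd t * conj (y t)).im)
      (((W x).im - lam.im) * Complex.normSq (y x)) (Set.Icc (0:ℝ) 1) x := by
    intro x hx
    have h := Complex.imCLM.hasFDerivAt.comp_hasDerivWithinAt x ((hyd x hx).mul (hy x hx).star)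
    refine h.congr_deriv ?_
    simp [Complex.normSq_apply]
    ring
  intro x hx
  have hWx := hW x hx
  have hzero : ((W x).im - lam.im) * Complex.normSq (y x) = 0 := by
    rcases le_total 0 lam.im with hl | hl
    · refine deriv_eq_zero_of_nonpos_of_eq_ends hF (fun t ht => ?_) hflux x hx
      have := hW t ht
      rw [abs_of_nonneg hl, abs_lt] at this
      exact mul_nonpos_of_nonpos_of_nonneg (by linarith) (Complex.normSq_nonneg _)
    · refine neg_eq_zero.mp (deriv_eq_zero_of_nonpos_of_eq_ends (fun t ht => (hF t ht).fun_neg)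
        (fun t ht => ?_) (by rw [hflux]) x hx)
      have := hW t ht
      rw [abs_of_nonpos hl, abs_lt] at this
      exact neg_nonpos.mpr (mul_nonneg (by linarith) (Complex.normSq_nonneg _))
  rcases mul_eq_zero.mp hzero with h | h
  · rw [sub_eq_zero.mp h] at hWx
    exact absurd hWx (lt_irrefl _)
  · exact Complex.normSq_eq_zero.mp h

theorem spectrum_real_in_half_plane
    (D : Set ℂ) (hD : IsOpen D) (V : ℝ → ℂ → ℂ) (a ξ : ℝ) (hξ0 : 0 ≤ ξ)
    (hVx : ∀ lam ∈ D, ContinuousOn (fun x => V x lam) (Set.Icc (0:ℝ) 1))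
    (hVhol : ∀ x ∈ Set.Icc (0:ℝ) 1, DifferentiableOn ℂ (V x) D)
    (hVreal : ∀ x ∈ Set.Icc (0:ℝ) 1, ∀ μ : ℝ, (μ : ℂ) ∈ D → (V x μ).im = 0)
    (hξ : ∀ x ∈ Set.Icc (0:ℝ) 1, ∀ lam ∈ D, a < lam.re → |(V x lam).im| ≤ ξ)
    (hstrip : {w : ℂ | a < w.re ∧ |w.im| < ξ / (2 - Real.sqrt 3)} ⊆ D)
    (lam : ℂ) (hlam : lam ∈ D) (hre : a + ξ / (2 - Real.sqrt 3) < lam.re)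
    (heig : (∃ k : ℝ, 0 ≤ k ∧ k < 2 * Real.pi ∧ HillQPEigen (fun x => V x lam) k lam) ∨
            HillDirichletEigen (fun x => V x lam) lam ∨
            HillNeumannEigen (fun x => V x lam) lam) :
    lam.im = 0 ∧ a + ξ / (2 - Real.sqrt 3) < lam.re := by
  refine ⟨?_, hre⟩
  by_contra him
  have hs3 : Real.sqrt 3 < 2 := by
    rw [Real.sqrt_lt' (by norm_num)]
    norm_num
  have hs1 : 1 < Real.sqrt 3 := by
    rw [Real.lt_sqrt (by norm_num)]
    norm_num
  have hsq : Real.sqrt 3 ^ 2 = 3 := Real.sq_sqrt (by norm_num)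
  have hρ : ξ / (2 - Real.sqrt 3) = ξ * (2 + Real.sqrt 3) := by
    rw [div_eq_iff (by linarith)]
    linear_combination ξ * hsq
  rw [hρ] at hstrip hre
  have hβ : 0 < |lam.im| := abs_pos.mpr him
  have ha : a < lam.re := by nlinarith
  have hlt : ∀ x ∈ Set.Icc (0:ℝ) 1, |(V x lam).im| < |lam.im| := by
    intro x hx
    rcases lt_or_ge ξ |lam.im| with h | h
    · exact (hξ x hx lam hlam ha).trans_lt h
    have hξpos : 0 < ξ := hβ.trans_le h
    set R := ξ * (2 + Real.sqrt 3) with hR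
    have hball : ∀ w ∈ Metric.ball (lam.re : ℂ) R, a < w.re ∧ |w.im| < R := by
      intro w hw
      rw [Metric.mem_ball, dist_eq_norm] at hw
      have hwre := abs_lt.mp ((Complex.abs_re_le_norm _).trans_lt hw)
      have hwim := (Complex.abs_im_le_norm _).trans_lt hw
      simp only [Complex.sub_re, Complex.sub_im, Complex.ofReal_re, Complex.ofReal_im,
        sub_zero] at hwre hwim
      exact ⟨by linarith, hwim⟩
    have hRpos : 0 < R := by positivity
    have hgap : 2 * ξ < R - |lam.im| := by nlinarith
    have hnorm : ‖lam - lam.re‖ = |lam.im| := by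
      have : lam - lam.re = lam.im * Complex.I := by
        apply Complex.ext <;> simp
      simp [this]
    have hbound := abs_im_le_of_im_le_on_ball hξpos
      ((hVhol x hx).mono fun w hw => hstrip (hball w hw))
      (fun w hw => (le_abs_self _).trans (hξ x hx w (hstrip (hball w hw)) (hball w hw).1))
      (hVreal x hx lam.re (hstrip (hball _ (Metric.mem_ball_self hRpos))))
      (z := lam) (by rw [Metric.mem_ball, dist_eq_norm, hnorm]; linarith)
    rw [hnorm] at hbound
    refine hbound.trans_lt ?_
    rw [div_lt_iff₀ (by linarith)]
    nlinarith
  rcases heig with ⟨k, -, -, y, yd, ⟨x, hx, hne⟩, hy, hyd, h1, h2⟩ |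
    ⟨y, yd, ⟨x, hx, hne⟩, hy, hyd, h1, h2⟩ | ⟨y, yd, ⟨x, hx, hne⟩, hy, hyd, h1, h2⟩
  · refine hne (solution_eq_zero_of_flux_eq hy hyd hlt ?_ x hx)
    have hunit :
        Complex.exp (Complex.I * k) * (starRingEnd ℂ) (Complex.exp (Complex.I * k)) = 1 := by
      rw [Complex.mul_conj, Complex.normSq_eq_norm_sq, mul_comm, Complex.norm_exp_ofReal_mul_I]
      simp
    rw [h1, h2, map_mul, mul_mul_mul_comm, hunit, one_mul]
  · exact hne (solution_eq_zero_of_flux_eq hy hyd hlt (by simp [h1, h2]) x hx)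
  · exact hne (solution_eq_zero_of_flux_eq hy hyd hlt (by simp [h1, h2]) x hx)
end

section
/- Let a ∈ ℝ and let U ⊆ ℂ be open with (a, ∞) ⊆ U. Let Δ : U → ℂ be holomorphic with Δ(λ) ∈ ℝ for all real λ > a, and assume that every λ ∈ U with Δ(λ) real and −1 ≤ Δ(λ) ≤ 1 satisfies Im λ = 0. Then for every real λ > a: (i) if −1 < Δ(λ) < 1 then Δ'(λ) ≠ 0; and (ii) if Δ(λ) = 1 or Δ(λ) = −1 and Δ'(λ) = 0, then Δ(λ) · Δ''(λ) < 0 (here Δ''(λ) is real since Δ is real on (a,∞)). -/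
open MeasureTheory

open Filter Topology

/-- A nonzero complex number has an `n`-th root in the open upper half-plane for every `n ≥ 2`,
except for square roots of positive reals. -/
lemma Complex.exists_pow_eq_of_im_pos {n : ℕ} (hn : 2 ≤ n) {u : ℂ} (hu : u ≠ 0)
    (h : n ≠ 2 ∨ u.arg ≠ 0) : ∃ ω : ℂ, ω ^ n = u ∧ 0 < ω.im := by
  have hn0 : (n : ℂ) ≠ 0 := by exact_mod_cast (by lia : n ≠ 0)
  have hnR : (2 : ℝ) ≤ n := by exact_mod_cast hn
  have hpos : (0 : ℝ) < n := by linarith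
  have key : ∀ v : ℂ, Complex.exp v = u → 0 < v.im → v.im < n * Real.pi →
      ∃ ω : ℂ, ω ^ n = u ∧ 0 < ω.im := by
    intro v hv h0 h1
    refine ⟨Complex.exp (v / n), ?_, ?_⟩
    · rw [← Complex.exp_nat_mul, mul_div_cancel₀ _ hn0, hv]
    · rw [Complex.exp_im, Complex.div_natCast_im]
      refine mul_pos (Real.exp_pos _) (Real.sin_pos_of_pos_of_lt_pi (by positivity) ?_)
      rwa [div_lt_iff₀ hpos, mul_comm]
  have hpi := Real.pi_pos
  rcases lt_or_ge 0 u.arg with h0 | h0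
  · refine key (Complex.log u) (Complex.exp_log hu) (by rwa [Complex.log_im]) ?_
    rw [Complex.log_im]
    nlinarith [Complex.arg_le_pi u]
  · refine key (Complex.log u + 2 * Real.pi * Complex.I) ?_ ?_ ?_
    · rw [Complex.exp_add, Complex.exp_log hu, Complex.exp_two_pi_mul_I, mul_one]
    · simp [Complex.log_im]
      linarith [Complex.neg_pi_lt_arg u]
    · simp [Complex.log_im]
      rcases h with h | h
      · have : (3 : ℝ) ≤ n := by exact_mod_cast (by lia : 3 ≤ n)
        nlinarith
      · nlinarith [lt_of_le_of_ne h0 h]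

/-- Near a zero of order `n`, an analytic function pulls back to a pure power along a curve with
any prescribed initial velocity. -/
lemma AnalyticAt.exists_curve_pow_mul {h : ℂ → ℂ} {z₀ : ℂ} (hh : AnalyticAt ℂ h z₀)
    (h0 : h z₀ ≠ 0) {n : ℕ} (hn : n ≠ 0) (ω : ℂ) :
    ∃ γ : ℝ → ℂ, γ 0 = z₀ ∧ HasDerivAt γ ω 0 ∧
      ∀ᶠ ε : ℝ in 𝓝 0, (γ ε - z₀) ^ n * h (γ ε) = (ε : ℂ) ^ n * (ω ^ n * h z₀) := by
  have hnC : (n : ℂ) ≠ 0 := by exact_mod_cast hn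
  set k : ℂ → ℂ := fun z => Complex.exp (Complex.log (h z / h z₀) / n) with hk
  have hka : AnalyticAt ℂ k z₀ := by
    refine AnalyticAt.cexp (AnalyticAt.div (AnalyticAt.clog (hh.div analyticAt_const h0) ?_)
      analyticAt_const hnC)
    simp [div_self h0]
  have hk0 : k z₀ = 1 := by simp [hk, div_self h0]
  have hkn : ∀ᶠ z in 𝓝 z₀, k z ^ n * h z₀ = h z := by
    filter_upwards [hh.continuousAt.eventually_ne h0] with z hz
    simp only [hk]
    rw [← Complex.exp_nat_mul, mul_div_cancel₀ _ hnC, Complex.exp_log (div_ne_zero hz h0),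
      div_mul_cancel₀ _ h0]
  set φ : ℂ → ℂ := fun z => (z - z₀) * k z with hφ
  have hφa : AnalyticAt ℂ φ z₀ := (analyticAt_id.sub analyticAt_const).mul hka
  have hφd : HasDerivAt φ 1 z₀ := by
    have := ((hasDerivAt_id z₀).sub_const z₀).fun_mul hka.differentiableAt.hasDerivAt
    simpa [hk0] using this
  have hφs : HasStrictDerivAt φ 1 z₀ := by
    simpa [hφd.deriv] using hφa.hasStrictDerivAt
  have hφ0 : φ z₀ = 0 := by simp [hφ]
  set ψ := hφs.localInverse φ 1 z₀ one_ne_zero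
  have hψd : HasDerivAt ψ 1 0 := by
    simpa [hφ0] using (hφs.to_localInverse one_ne_zero).hasDerivAt
  have hψr : ∀ᶠ w in 𝓝 (0 : ℂ), φ (ψ w) = w := by
    have := hφs.eventually_right_inverse one_ne_zero
    rwa [hφ0] at this
  have hψ0 : ψ 0 = z₀ := by
    have := (hφs.hasStrictFDerivAt_equiv one_ne_zero).localInverse_apply_image
    rwa [hφ0] at this
  have hline : HasDerivAt (fun ε : ℝ => (ε : ℂ) * ω) ω 0 := by
    simpa using (Complex.ofRealCLM.hasDerivAt (x := (0 : ℝ))).mul_const ω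
  have hγd : HasDerivAt (fun ε : ℝ => ψ (ε * ω)) ω 0 := by
    have := HasDerivAt.comp (𝕜 := ℝ) (𝕜' := ℂ) (h₂ := ψ) (h₂' := 1) (0 : ℝ)
      (by simpa using hψd) hline
    simpa [Function.comp_def] using this
  have hl0 : Tendsto (fun ε : ℝ => (ε : ℂ) * ω) (𝓝 0) (𝓝 0) := by
    simpa using hline.continuousAt.tendsto
  have hγ0 : Tendsto (fun ε : ℝ => ψ (ε * ω)) (𝓝 0) (𝓝 z₀) := by
    simpa [hψ0] using hγd.continuousAt.tendsto
  refine ⟨fun ε => ψ (ε * ω), by simpa using hψ0, hγd, ?_⟩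
  filter_upwards [hl0.eventually hψr, hγ0.eventually hkn] with ε h1 h2
  rw [← h2, ← mul_assoc, ← mul_pow, ← mul_assoc, ← mul_pow]
  exact congrArg (fun x => x ^ n * h z₀) h1

/-- Near a real zero of order `n ≥ 2` of `f - f t`, the function `f` takes values `f t + δ s`
at points off the real axis, unless `n = 2` and `s` has the sign of the leading coefficient. -/
lemma AnalyticAt.exists_im_pos_eq_add {f h : ℂ → ℂ} {t : ℝ} (hh : AnalyticAt ℂ h t)
    (h0 : h t ≠ 0) {n : ℕ} (hn : 2 ≤ n)
    (hf : ∀ᶠ z in 𝓝 (t : ℂ), f z = f t + (z - t) ^ n * h z) {s : ℝ} (hs : s ≠ 0)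
    (hns : n ≠ 2 ∨ ((s : ℂ) / h t).arg ≠ 0) {U : Set ℂ} (hU : U ∈ 𝓝 (t : ℂ)) {r : ℝ}
    (hr : 0 < r) :
    ∃ z ∈ U, ∃ δ : ℝ, 0 < δ ∧ δ < r ∧ 0 < z.im ∧ f z = f t + (δ * s : ℝ) := by
  have hsC : (s : ℂ) ≠ 0 := by exact_mod_cast hs
  obtain ⟨ω, hω, him⟩ := Complex.exists_pow_eq_of_im_pos hn (div_ne_zero hsC h0) hns
  obtain ⟨γ, hγ0, hγd, hγ⟩ := hh.exists_curve_pow_mul h0 (by lia : n ≠ 0) ω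
  have hγt : Tendsto γ (𝓝 0) (𝓝 (t : ℂ)) := by simpa [hγ0] using hγd.continuousAt.tendsto
  have himd : HasDerivAt (fun ε => (γ ε).im) ω.im 0 := by
    simpa [Function.comp_def] using
      (Complex.imCLM.hasFDerivAt (x := γ 0)).comp_hasDerivAt (0 : ℝ) hγd
  have himpos : ∀ᶠ ε : ℝ in 𝓝[>] 0, 0 < (γ ε).im := by
    have := (hasDerivAt_iff_tendsto_slope.1 himd).mono_left
      (nhdsWithin_mono (0 : ℝ) (fun x (hx : 0 < x) => hx.ne'))
    filter_upwards [this.eventually_const_lt him, self_mem_nhdsWithin] with ε h1 (h2 : 0 < ε)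
    simp only [slope_def_field, hγ0, Complex.ofReal_im, sub_zero] at h1
    exact (div_pos_iff_of_pos_right h2).1 h1
  have hpow : ∀ᶠ ε : ℝ in 𝓝 0, ε ^ n < r := by
    have : Tendsto (fun ε : ℝ => ε ^ n) (𝓝 0) (𝓝 0) := by
      simpa [(by lia : n ≠ 0)] using (continuous_pow (M := ℝ) n).tendsto 0
    exact this.eventually_lt_const hr
  obtain ⟨ε, hi, hε, hp, he, hU', hfe⟩ := (himpos.and
    ((eventually_mem_nhdsWithin (a := (0 : ℝ)) (s := Set.Ioi 0)).and
      ((hpow.and (hγ.and ((hγt.eventually hU).and (hγt.eventually hf)))).filter_mono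
        nhdsWithin_le_nhds))).exists
  refine ⟨γ ε, hU', ε ^ n, pow_pos hε n, hp, hi, ?_⟩
  rw [hfe, he, hω, div_mul_cancel₀ _ h0]
  push_cast
  rfl

/-- The second derivative at a point where `f z` is `c + (z - z₀) ^ 2 * h z`. -/
lemma AnalyticAt.iteratedDeriv_two_of_eventuallyEq {f h : ℂ → ℂ} {z₀ c : ℂ}
    (hh : AnalyticAt ℂ h z₀) (hf : ∀ᶠ z in 𝓝 z₀, f z = c + (z - z₀) ^ 2 * h z) :
    iteratedDeriv 2 f z₀ = 2 * h z₀ := by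
  have h1 : deriv f =ᶠ[𝓝 z₀] fun z => 2 * (z - z₀) * h z + (z - z₀) ^ 2 * deriv h z := by
    filter_upwards [hf.eventually_nhds, hh.eventually_analyticAt] with z hz hhz
    have hp : HasDerivAt (fun w : ℂ => (w - z₀) ^ 2) (2 * (z - z₀)) z := by
      simpa using ((hasDerivAt_id z).sub_const z₀).fun_pow 2
    rw [EventuallyEq.deriv_eq hz]
    exact ((hp.mul hhz.differentiableAt.hasDerivAt).const_add c).deriv
  have hl : HasDerivAt (fun w : ℂ => 2 * (w - z₀)) 2 z₀ := by
    simpa using ((hasDerivAt_id z₀).sub_const z₀).const_mul 2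
  have hp : HasDerivAt (fun w : ℂ => (w - z₀) ^ 2) 0 z₀ := by
    simpa using ((hasDerivAt_id z₀).sub_const z₀).fun_pow 2
  rw [iteratedDeriv_succ, iteratedDeriv_one, h1.deriv_eq]
  simpa using ((hl.fun_mul hh.differentiableAt.hasDerivAt).fun_add
    (hp.fun_mul hh.deriv.differentiableAt.hasDerivAt)).deriv

/-- At a real critical point `t` of `f`, and for a sign `s` such that `f` takes no
value `f t + δ s` with small `δ ≥ 0` off the real axis, the second derivative at `t`
has nonzero real part, of the sign of `s`. -/
lemma AnalyticAt.re_iteratedDeriv_two_pos {f : ℂ → ℂ} {t : ℝ} (hf : AnalyticAt ℂ f t)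
    (hd : deriv f t = 0) {U : Set ℂ} (hU : U ∈ 𝓝 (t : ℂ)) {s r : ℝ} (hs : s ≠ 0) (hr : 0 < r)
    (hspec : ∀ z ∈ U, ∀ δ : ℝ, 0 ≤ δ → δ < r → f z = f t + (δ * s : ℝ) → z.im = 0) :
    0 < s * (iteratedDeriv 2 f t).re := by
  have hnc : ¬ ∀ᶠ z in 𝓝 (t : ℂ), f z - f t = 0 := by
    intro hc
    have hline : Tendsto (fun ε : ℝ => (t : ℂ) + ε * Complex.I) (𝓝[>] 0) (𝓝 (t : ℂ)) := by
      have : Continuous (fun ε : ℝ => (t : ℂ) + ε * Complex.I) := by fun_prop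
      simpa using (this.tendsto 0).mono_left nhdsWithin_le_nhds
    obtain ⟨ε, h1, h2, h3⟩ := ((hline.eventually hc).and
      ((hline.eventually hU).and self_mem_nhdsWithin)).exists
    have := hspec _ h2 0 le_rfl hr (by simpa [sub_eq_zero] using h1)
    simp at this
    exact (ne_of_gt h3) this
  obtain ⟨n, h, hh, h0, hfh⟩ :=
    (hf.sub analyticAt_const).exists_eventuallyEq_pow_smul_nonzero_iff.2 hnc
  have hfe : ∀ᶠ z in 𝓝 (t : ℂ), f z = f t + (z - t) ^ n * h z := by
    filter_upwards [hfh] with z hz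
    rw [← smul_eq_mul, ← hz]
    simp
  have hn : 2 ≤ n := by
    by_contra! hlt
    interval_cases n
    · simpa [h0] using hfe.self_of_nhds
    · have : HasDerivAt (fun z => f t + (z - t) ^ 1 * h z) (h t) (t : ℂ) := by
        simpa using (((hasDerivAt_id (t : ℂ)).sub_const (t : ℂ)).mul
          hh.differentiableAt.hasDerivAt).const_add (f t)
      exact h0 (by rw [← this.deriv, ← EventuallyEq.deriv_eq hfe, hd])
  by_cases hns : n ≠ 2 ∨ ((s : ℂ) / h t).arg ≠ 0
  · obtain ⟨z, hz, δ, hδ, hδr, him, he⟩ := hh.exists_im_pos_eq_add h0 hn hfe hs hns hU hr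
    exact absurd (hspec z hz δ hδ.le hδr he) him.ne'
  · push Not at hns
    obtain ⟨rfl, harg⟩ := hns
    rw [hh.iteratedDeriv_two_of_eventuallyEq hfe]
    obtain ⟨hre, him⟩ := Complex.arg_eq_zero_iff.1 harg
    have hsC : (s : ℂ) ≠ 0 := by exact_mod_cast hs
    set q := (s : ℂ) / h t with hq
    have hq0 : q ≠ 0 := div_ne_zero hsC h0
    have hmul : (s : ℂ) = q * h t := by rw [hq, div_mul_cancel₀ _ h0]
    have hsre : s = q.re * (h t).re := by simpa [him] using congrArg Complex.re hmul
    have hqre : 0 < q.re := lt_of_le_of_ne hre fun h => hq0 (Complex.ext h.symm him)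
    have hhre : (h t).re ≠ 0 := fun h => hs (by rw [hsre, h, mul_zero])
    have : (2 * h t).re = 2 * (h t).re := by simp
    rw [this, hsre]
    have := mul_pos hqre (pow_pos (abs_pos.2 hhre) 2)
    rw [sq_abs] at this
    nlinarith

theorem lyapunov_monotonicity_when_spectrum_real
    (a : ℝ) (U : Set ℂ) (hU : IsOpen U)
    (haU : ∀ t : ℝ, a < t → (t : ℂ) ∈ U)
    (Δ : ℂ → ℂ) (hΔ : DifferentiableOn ℂ Δ U)
    (hreal : ∀ t : ℝ, a < t → (Δ (t : ℂ)).im = 0)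
    (hspec : ∀ lam ∈ U, (Δ lam).im = 0 → -1 ≤ (Δ lam).re → (Δ lam).re ≤ 1 →
      lam.im = 0) :
    ∀ t : ℝ, a < t →
      ((-1 < (Δ (t : ℂ)).re → (Δ (t : ℂ)).re < 1 → deriv Δ (t : ℂ) ≠ 0) ∧
       ((Δ (t : ℂ) = 1 ∨ Δ (t : ℂ) = -1) → deriv Δ (t : ℂ) = 0 →
        (Δ (t : ℂ)).re * (iteratedDeriv 2 Δ (t : ℂ)).re < 0)) := by
  intro t ht
  have hUt : U ∈ 𝓝 (t : ℂ) := hU.mem_nhds (haU t ht)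
  have hΔt : AnalyticAt ℂ Δ t := hΔ.analyticAt hUt
  have key : ∀ s r : ℝ, s ≠ 0 → 0 < r → deriv Δ t = 0 →
      (∀ δ : ℝ, 0 ≤ δ → δ < r → -1 ≤ (Δ t).re + δ * s ∧ (Δ t).re + δ * s ≤ 1) →
      0 < s * (iteratedDeriv 2 Δ t).re := by
    intro s r hs hr hd hsr
    refine hΔt.re_iteratedDeriv_two_pos hd hUt hs hr fun z hz δ hδ hδr he => ?_
    have hre : (Δ z).re = (Δ t).re + δ * s := by rw [he, Complex.add_re, Complex.ofReal_re]
    have him : (Δ z).im = 0 := by rw [he, Complex.add_im, Complex.ofReal_im, hreal t ht, add_zero]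
    obtain ⟨h1, h2⟩ := hsr δ hδ hδr
    exact hspec z hz him (hre ▸ h1) (hre ▸ h2)
  refine ⟨fun h1 h2 hd => ?_, ?_⟩
  · have hp := key 1 (1 - (Δ t).re) one_ne_zero (by linarith) hd
      fun δ h h' => ⟨by linarith, by linarith⟩
    have hm := key (-1) (1 + (Δ t).re) (by norm_num) (by linarith) hd
      fun δ h h' => ⟨by linarith, by linarith⟩
    linarith
  · rintro (h | h) hd
    · have := key (-1) 1 (by norm_num) one_pos hd
        fun δ h1 h2 => by rw [h, Complex.one_re]; constructor <;> linarith
      rw [h, Complex.one_re]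
      linarith
    · have := key 1 1 one_ne_zero one_pos hd
        fun δ h1 h2 => by rw [h, Complex.neg_re, Complex.one_re]; constructor <;> linarith
      rw [h, Complex.neg_re, Complex.one_re]
      linarith
end

section
/- Let N ≥ 1, let κ₁, …, κ_N > 0, and let q₁, …, q_N : [0,1] → ℝ be continuous, with ‖q‖_∞ denoting the supremum norm. Define V₁(x,λ) = Σ_{n=1}^{N} qₙ(x) e^{−κₙ λ} for (x,λ) ∈ [0,1] × ℂ, and set μ₁ = (2−√3)^{−1} Σ_{n=1}^{N} ‖qₙ‖_∞. If λ ∈ ℂ with Re λ > μ₁ is an eigenvalue of the quasi-periodic problem with some parameter k ∈ [0,2π), or a Dirichlet eigenvalue, or a Neumann eigenvalue, for the potential x ↦ V₁(x,λ), then λ is real. -/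
open MeasureTheory

/-- If `Im W` and `Im lam` satisfy `Im lam * Im W < (Im lam)^2` on `[0,1]`, then a solution of
`-y'' + W y = lam y` for which `Im (conj y * y')` takes the same value at both endpoints
vanishes identically. -/
theorem eqOn_zero_of_im_conj_mul_deriv_eq {W : ℝ → ℂ} {lam : ℂ} {y yd : ℝ → ℂ}
    (hW : ∀ x ∈ Set.Icc (0:ℝ) 1, lam.im * (W x).im < lam.im * lam.im)
    (hy : ∀ x ∈ Set.Icc (0:ℝ) 1, HasDerivWithinAt y (yd x) (Set.Icc (0:ℝ) 1) x)
    (hyd : ∀ x ∈ Set.Icc (0:ℝ) 1,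
      HasDerivWithinAt yd (W x * y x - lam * y x) (Set.Icc (0:ℝ) 1) x)
    (hb : (star (y 0) * yd 0).im = (star (y 1) * yd 1).im) :
    ∀ x ∈ Set.Icc (0:ℝ) 1, y x = 0 := by
  set G : ℝ → ℝ := fun x => lam.im * (star (y x) * yd x).im with hG
  have hderiv : ∀ x ∈ Set.Icc (0:ℝ) 1,
      HasDerivWithinAt G ((lam.im * (W x).im - lam.im * lam.im) * Complex.normSq (y x))
        (Set.Icc (0:ℝ) 1) x := by
    intro x hx
    have h := Complex.imCLM.hasFDerivAt.comp_hasDerivWithinAt x ((hy x hx).star.mul (hyd x hx))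
    refine (h.const_mul lam.im).congr_deriv ?_
    simp only [Complex.imCLM_apply, Complex.star_def, Complex.add_im, Complex.mul_im,
      Complex.mul_re, Complex.sub_re, Complex.sub_im, Complex.conj_re, Complex.conj_im,
      Complex.normSq_apply]
    ring
  have hanti : AntitoneOn G (Set.Icc 0 1) := by
    refine antitoneOn_of_hasDerivWithinAt_nonpos (convex_Icc 0 1)
      (fun x hx => (hderiv x hx).continuousWithinAt)
      (fun x hx => (hderiv x (interior_subset hx)).mono interior_subset) fun x hx => ?_
    exact mul_nonpos_of_nonpos_of_nonneg (by linarith [hW x (interior_subset hx)])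
      (Complex.normSq_nonneg _)
  have h01 : G 0 = G 1 := by simp only [hG, hb]
  have hconst : ∀ x ∈ Set.Icc (0:ℝ) 1, G x = G 0 := fun x hx =>
    le_antisymm (hanti (Set.left_mem_Icc.2 zero_le_one) hx hx.1)
      (h01.le.trans (hanti hx (Set.right_mem_Icc.2 zero_le_one) hx.2))
  intro x hx
  have hzero : HasDerivWithinAt G 0 (Set.Icc (0:ℝ) 1) x :=
    (hasDerivWithinAt_const x _ (G 0)).congr hconst (hconst x hx)
  have heq := (uniqueDiffOn_Icc zero_lt_one x hx).eq_deriv _ (hderiv x hx) hzero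
  rcases mul_eq_zero.1 heq with h | h
  · linarith [hW x hx]
  · exact Complex.normSq_eq_zero.1 h

/-- For `κ ≥ 0` and `0 < Re z`, `|Im e^{-κ z}| ≤ |Im z| / Re z`. -/
theorem abs_im_exp_neg_mul_le {κ : ℝ} (hκ : 0 ≤ κ) {z : ℂ} (hz : 0 < z.re) :
    |(Complex.exp (-(κ : ℂ) * z)).im| ≤ |z.im| / z.re := by
  have him : (Complex.exp (-(κ : ℂ) * z)).im = Real.exp (-(κ * z.re)) * Real.sin (-(κ * z.im)) := by
    simp [Complex.exp_im]
  have hsin : |Real.sin (-(κ * z.im))| ≤ κ * |z.im| :=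
    Real.abs_sin_le_abs.trans_eq (by rw [abs_neg, abs_mul, abs_of_nonneg hκ])
  have hexp : Real.exp (-(κ * z.re)) * (κ * z.re) ≤ 1 := by
    rw [Real.exp_neg, inv_mul_le_one₀ (Real.exp_pos _)]
    linarith [Real.add_one_le_exp (κ * z.re)]
  rw [him, abs_mul, Real.abs_exp, le_div_iff₀ hz]
  calc Real.exp (-(κ * z.re)) * |Real.sin (-(κ * z.im))| * z.re
      ≤ Real.exp (-(κ * z.re)) * (κ * |z.im|) * z.re := by gcongr
    _ = Real.exp (-(κ * z.re)) * (κ * z.re) * |z.im| := by ring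
    _ ≤ 1 * |z.im| := by gcongr
    _ = |z.im| := one_mul _

theorem example_exponential_potential_real_spectrum
    (N : ℕ) (hN : 1 ≤ N)
    (κ : Fin N → ℝ) (hκ : ∀ n, 0 < κ n)
    (q : Fin N → ℝ → ℝ) (hq : ∀ n, ContinuousOn (q n) (Set.Icc (0:ℝ) 1))
    (lam : ℂ)
    (hre : (∑ n, ⨆ x : Set.Icc (0:ℝ) 1, |q n x.1|) / (2 - Real.sqrt 3) < lam.re)
    (heig :
      (∃ k : ℝ, 0 ≤ k ∧ k < 2 * Real.pi ∧
        HillQPEigen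
          (fun x => ∑ n, (q n x : ℂ) * Complex.exp (-(κ n : ℂ) * lam)) k lam) ∨
      HillDirichletEigen
        (fun x => ∑ n, (q n x : ℂ) * Complex.exp (-(κ n : ℂ) * lam)) lam ∨
      HillNeumannEigen
        (fun x => ∑ n, (q n x : ℂ) * Complex.exp (-(κ n : ℂ) * lam)) lam) :
    lam.im = 0 := by
  have h3 : Real.sqrt 3 < 2 := (Real.sqrt_lt' two_pos).2 (by norm_num)
  have h3' : 1 ≤ Real.sqrt 3 := Real.one_le_sqrt.2 (by norm_num)
  set S : ℝ := ∑ n, ⨆ x : Set.Icc (0:ℝ) 1, |q n x.1| with hS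
  have hS0 : 0 ≤ S := Finset.sum_nonneg fun n _ => Real.iSup_nonneg fun x => abs_nonneg _
  have ha : 0 < lam.re := (div_nonneg hS0 (by linarith)).trans_lt hre
  have hSa : S < lam.re := by
    rw [div_lt_iff₀ (by linarith)] at hre
    nlinarith
  by_contra him
  have hqle : ∀ n, ∀ x ∈ Set.Icc (0:ℝ) 1, |q n x| ≤ ⨆ x : Set.Icc (0:ℝ) 1, |q n x.1| := by
    intro n x hx
    have hbdd : BddAbove (Set.range fun x : Set.Icc (0:ℝ) 1 => |q n x.1|) := by
      have h := isCompact_Icc.bddAbove_image (hq n).abs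
      rwa [Set.image_eq_range] at h
    exact le_ciSup hbdd ⟨x, hx⟩
  have hW : ∀ x ∈ Set.Icc (0:ℝ) 1,
      lam.im * (∑ n, (q n x : ℂ) * Complex.exp (-(κ n : ℂ) * lam)).im < lam.im * lam.im := by
    intro x hx
    have hle : |(∑ n, (q n x : ℂ) * Complex.exp (-(κ n : ℂ) * lam)).im|
        ≤ S * (|lam.im| / lam.re) := by
      rw [Complex.im_sum, hS, Finset.sum_mul]
      refine (Finset.abs_sum_le_sum_abs _ _).trans (Finset.sum_le_sum fun n _ => ?_)
      rw [Complex.im_ofReal_mul, abs_mul]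
      exact mul_le_mul (hqle n x hx) (abs_im_exp_neg_mul_le (hκ n).le ha) (abs_nonneg _)
        ((abs_nonneg _).trans (hqle n x hx))
    have hpos : 0 < |lam.im| := abs_pos.2 him
    have hlt : S * (|lam.im| / lam.re) < |lam.im| := by
      rw [← mul_div_assoc, div_lt_iff₀ ha, mul_comm]
      gcongr
    calc _ ≤ |lam.im * _| := le_abs_self _
      _ = |lam.im| * |_| := abs_mul _ _
      _ < |lam.im| * |lam.im| := mul_lt_mul_of_pos_left (hle.trans_lt hlt) hpos
      _ = lam.im * lam.im := abs_mul_abs_self _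
  rcases heig with ⟨k, -, -, y, yd, ⟨x, hx, hne⟩, hy, hyd, h0, h1⟩ |
    ⟨y, yd, ⟨x, hx, hne⟩, hy, hyd, h0, h1⟩ | ⟨y, yd, ⟨x, hx, hne⟩, hy, hyd, h0, h1⟩
  · refine hne (eqOn_zero_of_im_conj_mul_deriv_eq hW hy hyd ?_ x hx)
    have hunit : star (Complex.exp (Complex.I * k)) * Complex.exp (Complex.I * k) = 1 := by
      rw [Complex.star_def, ← Complex.exp_conj, ← Complex.exp_add]
      simp
    rw [h0, h1, star_mul', mul_mul_mul_comm, hunit, one_mul]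
  · exact hne (eqOn_zero_of_im_conj_mul_deriv_eq hW hy hyd (by simp [h0, h1]) x hx)
  · exact hne (eqOn_zero_of_im_conj_mul_deriv_eq hW hy hyd (by simp [h0, h1]) x hx)
end

section
/- Let N ≥ 1, let κ₁, …, κ_N > 0, and let q₁, …, q_N : [0,1] → ℝ be continuous, with ‖q‖_∞ denoting the supremum norm, and assume Σ_{n=1}^{N} κₙ ‖qₙ‖_∞ < 1. Define V₂(x,λ) = Σ_{n=1}^{N} qₙ(x) cos(κₙ λ) for (x,λ) ∈ [0,1] × ℂ. Then there exists δ > 0 such that every λ ∈ ℂ with |Im λ| < δ that is an eigenvalue of the quasi-periodic problem with some parameter k ∈ [0,2π), or a Dirichlet eigenvalue, or a Neumann eigenvalue, for the potential x ↦ V₂(x,λ), is real. -/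
open MeasureTheory

open ComplexConjugate in
/-- If `y` solves `-y'' + W y = lam y`, the imaginary Wronskian `Im (conj y * y')` has equal values
at both endpoints and `|Im W| < |Im lam|` off the real axis, then a nontrivial `y` forces `lam` to be
real. -/
theorem im_eq_zero_of_wronskian_endpoints_eq {W y yd : ℝ → ℂ} {lam : ℂ}
    (hne : ∃ x ∈ Set.Icc (0:ℝ) 1, y x ≠ 0)
    (hy : ∀ x ∈ Set.Icc (0:ℝ) 1, HasDerivWithinAt y (yd x) (Set.Icc (0:ℝ) 1) x)
    (hyd : ∀ x ∈ Set.Icc (0:ℝ) 1,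
      HasDerivWithinAt yd (W x * y x - lam * y x) (Set.Icc (0:ℝ) 1) x)
    (hend : (conj (y 1) * yd 1).im = (conj (y 0) * yd 0).im)
    (hW : lam.im ≠ 0 → ∀ x ∈ Set.Icc (0:ℝ) 1, |(W x).im| < |lam.im|) :
    lam.im = 0 := by
  by_contra hb
  set G : ℝ → ℝ := fun x => lam.im * (conj (y x) * yd x).im with hG
  have hderiv : ∀ x ∈ Set.Icc (0:ℝ) 1, HasDerivWithinAt G
      (lam.im * (((W x).im - lam.im) * Complex.normSq (y x))) (Set.Icc (0:ℝ) 1) x := by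
    intro x hx
    have hconj : HasDerivWithinAt (fun t => conj (y t)) (conj (yd x)) (Set.Icc (0:ℝ) 1) x :=
      (hy x hx).star
    have him := Complex.imCLM.hasFDerivAt.comp_hasDerivWithinAt x (hconj.mul (hyd x hx))
    refine (him.const_mul lam.im).congr_deriv ?_
    simp only [Complex.imCLM_apply, Complex.add_im, Complex.sub_im, Complex.sub_re, Complex.mul_im,
      Complex.mul_re, Complex.conj_re, Complex.conj_im, Complex.normSq_apply]
    ring
  have hfactor : ∀ x ∈ Set.Icc (0:ℝ) 1, lam.im * ((W x).im - lam.im) < 0 := by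
    intro x hx
    have h1 : lam.im * (W x).im ≤ |lam.im| * |(W x).im| := by
      rw [← abs_mul]; exact le_abs_self _
    have h2 := mul_lt_mul_of_pos_left (hW hb x hx) (abs_pos.mpr hb)
    nlinarith [abs_mul_abs_self lam.im]
  have hanti : AntitoneOn G (Set.Icc (0:ℝ) 1) := by
    refine antitoneOn_of_hasDerivWithinAt_nonpos (convex_Icc 0 1)
      (fun x hx => (hderiv x hx).continuousWithinAt)
      (fun x hx => (hderiv x (interior_subset hx)).mono interior_subset) ?_
    intro x hx
    rw [← mul_assoc]
    exact mul_nonpos_of_nonpos_of_nonneg (hfactor x (interior_subset hx)).le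
      (Complex.normSq_nonneg _)
  have h01 : G 1 = G 0 := by simp only [hG, hend]
  have hconst : ∀ x ∈ Set.Icc (0:ℝ) 1, G x = G 0 := fun x hx =>
    le_antisymm (hanti (by simp) hx hx.1) (h01 ▸ hanti hx (by simp) hx.2)
  obtain ⟨x, hx, hyx⟩ := hne
  have hzero : HasDerivWithinAt G 0 (Set.Icc (0:ℝ) 1) x :=
    (hasDerivWithinAt_const x _ (G 0)).congr hconst (hconst x hx)
  have heq := (uniqueDiffOn_Icc zero_lt_one x hx).eq_deriv _ (hderiv x hx) hzero
  rw [← mul_assoc] at heq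
  exact mul_ne_zero (hfactor x hx).ne (by simpa using hyx) heq

theorem Complex.abs_cos_im_le_sinh (z : ℂ) : |(Complex.cos z).im| ≤ Real.sinh |z.im| := by
  have h : (Complex.cos z).im = -(Real.sin z.re * Real.sinh z.im) := by
    rw [Complex.cos_eq]
    simp [Complex.sin_ofReal_re, Complex.sinh_ofReal_re]
  rw [h, abs_neg, abs_mul, Real.abs_sinh]
  exact mul_le_of_le_one_left (Real.sinh_nonneg_iff.mpr (abs_nonneg _)) (Real.abs_sin_le_one _)

theorem exists_pos_sum_mul_sinh_lt {ι : Type*} [Fintype ι] (κ s : ι → ℝ)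
    (hsum : ∑ n, κ n * s n < 1) :
    ∃ δ > 0, ∀ t : ℝ, 0 < t → t < δ → ∑ n, s n * Real.sinh (κ n * t) < t := by
  have hderiv : HasDerivAt (fun t : ℝ => ∑ n, s n * Real.sinh (κ n * t)) (∑ n, κ n * s n) 0 := by
    refine HasDerivAt.fun_sum fun n _ => ?_
    refine ((((hasDerivAt_id (0:ℝ)).const_mul (κ n)).sinh).const_mul (s n)).congr_deriv ?_
    simp [mul_comm]
  have hev := (hasDerivAt_iff_tendsto_slope.mp hderiv).eventually_lt_const hsum
  obtain ⟨δ, hδ, h⟩ := Metric.eventually_nhds_iff.mp (eventually_nhdsWithin_iff.mp hev)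
  refine ⟨δ, hδ, fun t ht htδ => ?_⟩
  have hslope := h (y := t) (by simpa [abs_of_pos ht] using htδ) ht.ne'
  simpa [slope_def_field, div_lt_one ht] using hslope

theorem example_cosine_potential_real_spectrum_near_axis
    (N : ℕ) (hN : 1 ≤ N)
    (κ : Fin N → ℝ) (hκ : ∀ n, 0 < κ n)
    (q : Fin N → ℝ → ℝ) (hq : ∀ n, ContinuousOn (q n) (Set.Icc (0:ℝ) 1))
    (hsum : ∑ n, κ n * (⨆ x : Set.Icc (0:ℝ) 1, |q n x.1|) < 1) :
    ∃ δ > 0, ∀ lam : ℂ, |lam.im| < δ →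
      ((∃ k : ℝ, 0 ≤ k ∧ k < 2 * Real.pi ∧
          HillQPEigen
            (fun x => ∑ n, (q n x : ℂ) * Complex.cos ((κ n : ℂ) * lam)) k lam) ∨
        HillDirichletEigen
          (fun x => ∑ n, (q n x : ℂ) * Complex.cos ((κ n : ℂ) * lam)) lam ∨
        HillNeumannEigen
          (fun x => ∑ n, (q n x : ℂ) * Complex.cos ((κ n : ℂ) * lam)) lam) →
      lam.im = 0 := by
  obtain ⟨δ, hδ, hsinh⟩ := exists_pos_sum_mul_sinh_lt κ _ hsum
  refine ⟨δ, hδ, fun lam hlam heig => ?_⟩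
  have hW : lam.im ≠ 0 → ∀ x ∈ Set.Icc (0:ℝ) 1,
      |(∑ n, (q n x : ℂ) * Complex.cos ((κ n : ℂ) * lam)).im| < |lam.im| := by
    intro hb x hx
    refine lt_of_le_of_lt ?_ (hsinh _ (abs_pos.mpr hb) hlam)
    rw [Complex.im_sum]
    refine (Finset.abs_sum_le_sum_abs _ _).trans (Finset.sum_le_sum fun n _ => ?_)
    rw [Complex.im_ofReal_mul, abs_mul]
    have hbdd : BddAbove (Set.range fun x : Set.Icc (0:ℝ) 1 => |q n x.1|) := by
      have := isCompact_Icc.bddAbove_image (hq n).abs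
      rwa [Set.image_eq_range] at this
    have hqn : |q n x| ≤ ⨆ x : Set.Icc (0:ℝ) 1, |q n x.1| := le_ciSup hbdd ⟨x, hx⟩
    have hcos := Complex.abs_cos_im_le_sinh ((κ n : ℂ) * lam)
    rw [Complex.im_ofReal_mul, abs_mul, abs_of_pos (hκ n)] at hcos
    exact mul_le_mul hqn hcos (abs_nonneg _) ((abs_nonneg _).trans hqn)
  rcases heig with ⟨k, -, -, y, yd, hne, hy, hyd, h1, h2⟩ | ⟨y, yd, hne, hy, hyd, h1, h2⟩ |
    ⟨y, yd, hne, hy, hyd, h1, h2⟩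
  · refine im_eq_zero_of_wronskian_endpoints_eq hne hy hyd ?_ hW
    have hunit : (starRingEnd ℂ) (Complex.exp (Complex.I * k)) * Complex.exp (Complex.I * k) = 1 := by
      rw [← Complex.normSq_eq_conj_mul_self, Complex.normSq_eq_norm_sq, Complex.norm_exp]
      simp
    rw [h1, h2, map_mul, mul_mul_mul_comm, hunit, one_mul]
  · exact im_eq_zero_of_wronskian_endpoints_eq hne hy hyd (by simp [h1, h2]) hW
  · exact im_eq_zero_of_wronskian_endpoints_eq hne hy hyd (by simp [h1, h2]) hW
end

section
/- Let ζ ∈ ℂ, let p : ℝ → ℝ be continuously differentiable and q : ℝ → ℝ continuous. Suppose ψ : ℝ → ℂ is a three-times continuously differentiable solution of ψ''' + (pψ)' + pψ' + qψ = ζψ with ψ(x) ≠ 0 for all x ∈ ℝ, and suppose w : ℝ → ℂ is a nonvanishing differentiable function with w' = (3/2)(ψ'/ψ) w. Let y : ℝ → ℂ be any three-times continuously differentiable solution of y''' + (py)' + py' + qy = ζy, and set f = w · (y/ψ)'. Then f is twice differentiable and −f'' + 𝒱 f = 0, where 𝒱 = −2p − (3/4)( 2(ψ'/ψ)' + (ψ'/ψ)²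 ). -/
open MeasureTheory

/-- The successive derivatives of a `C³` function on the real line. -/
theorem ContDiff.hasDerivAt_three {g : ℝ → ℂ} (hg : ContDiff ℝ 3 g) (x : ℝ) :
    HasDerivAt g (deriv g x) x ∧ HasDerivAt (deriv g) (iteratedDeriv 2 g x) x ∧
      HasDerivAt (iteratedDeriv 2 g) (iteratedDeriv 3 g x) x := by
  refine ⟨(hg.differentiable (by norm_num) x).hasDerivAt, ?_, ?_⟩
  · have h := (hg.differentiable_iteratedDeriv 1 (by norm_num) x).hasDerivAt
    rwa [← iteratedDeriv_succ, iteratedDeriv_one] at h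
  · have h := (hg.differentiable_iteratedDeriv 2 (by norm_num) x).hasDerivAt
    rwa [← iteratedDeriv_succ] at h

theorem mckean_moser_reduction
    (ζ : ℂ) (p : ℝ → ℝ) (q : ℝ → ℝ)
    (hp : ContDiff ℝ 1 p) (hq : Continuous q)
    (ψ : ℝ → ℂ) (hψ : ContDiff ℝ 3 ψ)
    (hψ0 : ∀ x : ℝ, ψ x ≠ 0)
    (hψeq : ∀ x : ℝ,
      iteratedDeriv 3 ψ x + deriv (fun t => (p t : ℂ) * ψ t) x +
        (p x : ℂ) * deriv ψ x + (q x : ℂ) * ψ x = ζ * ψ x)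
    (w : ℝ → ℂ) (hw0 : ∀ x : ℝ, w x ≠ 0)
    (hw : ∀ x : ℝ, HasDerivAt w ((3 / 2) * (deriv ψ x / ψ x) * w x) x)
    (y : ℝ → ℂ) (hy : ContDiff ℝ 3 y)
    (hyeq : ∀ x : ℝ,
      iteratedDeriv 3 y x + deriv (fun t => (p t : ℂ) * y t) x +
        (p x : ℂ) * deriv y x + (q x : ℂ) * y x = ζ * y x) :
    (∀ x : ℝ, DifferentiableAt ℝ (fun t => w t * deriv (fun u => y u / ψ u) t) x) ∧
    (∀ x : ℝ, HasDerivAt (deriv (fun t => w t * deriv (fun u => y u / ψ u) t))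
      ((-2 * (p x : ℂ) - (3 / 4) *
          (2 * deriv (fun t => deriv ψ t / ψ t) x + (deriv ψ x / ψ x) ^ 2)) *
        (w x * deriv (fun u => y u / ψ u) x)) x) := by
  have hψd := hψ.hasDerivAt_three
  have hyd := hy.hasDerivAt_three
  have hquot : deriv (fun u => y u / ψ u) =
      fun t => (deriv y t * ψ t - y t * deriv ψ t) / ψ t ^ 2 :=
    funext fun t => ((hyd t).1.div (hψd t).1 (hψ0 t)).deriv
  have hwronskian : ∀ x, HasDerivAt (fun t => deriv y t * ψ t - y t * deriv ψ t)
      (iteratedDeriv 2 y x * ψ x - y x * iteratedDeriv 2 ψ x) x := fun x =>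
    (((hyd x).2.1.mul (hψd x).1).sub ((hyd x).1.mul (hψd x).2.1)).congr_deriv (by ring)
  have hf : ∀ x, HasDerivAt (fun t => w t * deriv (fun u => y u / ψ u) t)
      (w x * ((iteratedDeriv 2 y x * ψ x - y x * iteratedDeriv 2 ψ x) / ψ x ^ 2 -
        deriv ψ x * (deriv y x * ψ x - y x * deriv ψ x) / (2 * ψ x ^ 3))) x := by
    intro x
    have h0 := hψ0 x
    rw [hquot]
    refine ((hw x).mul ((hwronskian x).div ((hψd x).1.pow 2) (pow_ne_zero 2 h0))).congr_deriv ?_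
    simp only [Pi.pow_apply, Pi.div_apply]
    field_simp
    ring
  refine ⟨fun x => (hf x).differentiableAt, fun x => ?_⟩
  have h0 := hψ0 x
  have hpd : HasDerivAt (fun t => (p t : ℂ)) ((deriv p x : ℝ) : ℂ) x :=
    (hp.differentiable (by norm_num) x).hasDerivAt.ofReal_comp
  have hψx := hψeq x
  have hyx := hyeq x
  rw [(hpd.fun_mul (hψd x).1).deriv] at hψx
  rw [(hpd.fun_mul (hyd x).1).deriv] at hyx
  rw [funext fun t => (hf t).deriv, ((hψd x).2.1.fun_div (hψd x).1 h0).deriv, hquot]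
  refine ((hw x).mul (((((hyd x).2.2.mul (hψd x).1).sub ((hyd x).1.mul (hψd x).2.2)).div
    ((hψd x).1.pow 2) (pow_ne_zero 2 h0)).sub (((hψd x).2.1.mul (hwronskian x)).div
    (((hψd x).1.pow 3).const_mul 2) (mul_ne_zero two_ne_zero (pow_ne_zero 3 h0))))).congr_deriv ?_
  have hreduced : iteratedDeriv 3 y x * ψ x = y x * iteratedDeriv 3 ψ x -
      2 * p x * (deriv y x * ψ x - y x * deriv ψ x) := by
    linear_combination ψ x * hyx - y x * hψx
  simp only [Pi.pow_apply, Pi.mul_apply, Pi.sub_apply, Pi.div_apply, hreduced]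
  field_simp
  ring
end

section
/- Let a ∈ ℝ and for each real λ > a let V(·,λ) : [0,1] → ℝ be Lebesgue integrable. Assume there exists an integrable V_∞ : [0,1] → ℝ such that ∫₀¹ |V(s,λ) − V_∞(s)| ds → 0 and ∫₀¹ V(s,λ) ds → 0 as λ → +∞. For real λ > max(a,0) let Δ(λ) denote the Lyapunov function of the Hill equation −y'' + V(·,λ) y = λ y. Then for every ε > 0 there exists Λ > a such that every real λ > Λ with Δ(λ)² = 1 satisfies |λ − (πn)²| < ε for some integer n ≥ 1. (That is, the real 2-periodic eigenvalues λ_n^± satisfy λ_n^± = (πn)² + o(1) as n → ∞.) -/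
open MeasureTheory Filter

/-- `y` solves `-y'' + q y = z ^ 2 y` on `[0, 1]` in Duhamel form, with free part
`α cos (z x) + β sin (z x)`. -/
structure IsDuhamelSolution (z : ℝ) (q : ℝ → ℝ) (α β : ℝ) (y : ℝ → ℝ) : Prop where
  continuousOn : ContinuousOn y (Set.Icc 0 1)
  eq : ∀ x ∈ Set.Icc (0 : ℝ) 1, y x = α * Real.cos (z * x) + β * Real.sin (z * x) +
    z⁻¹ * ∫ s in (0 : ℝ)..x, Real.sin (z * (x - s)) * (q s * y s)

/-- The coefficient of `cos (z x)` in the variation of constants. -/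
noncomputable def cosAmplitude (z : ℝ) (q : ℝ → ℝ) (α : ℝ) (y : ℝ → ℝ) (x : ℝ) : ℝ :=
  α - z⁻¹ * ∫ s in (0 : ℝ)..x, Real.sin (z * s) * (q s * y s)

/-- The coefficient of `sin (z x)` in the variation of constants. -/
noncomputable def sinAmplitude (z : ℝ) (q : ℝ → ℝ) (β : ℝ) (y : ℝ → ℝ) (x : ℝ) : ℝ :=
  β + z⁻¹ * ∫ s in (0 : ℝ)..x, Real.cos (z * s) * (q s * y s)

section Integrals

variable {g q y : ℝ → ℝ} {z x : ℝ}

theorem intervalIntegrable_mul_of_continuousOn_Icc (hq : IntervalIntegrable q volume 0 1)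
    (hy : ContinuousOn y (Set.Icc 0 1)) :
    IntervalIntegrable (fun s => q s * y s) volume 0 1 :=
  hq.mul_continuousOn (by rwa [Set.uIcc_of_le zero_le_one])

theorem IntervalIntegrable.mono_right_Icc (hg : IntervalIntegrable g volume 0 1)
    (hx : x ∈ Set.Icc (0 : ℝ) 1) : IntervalIntegrable g volume 0 x :=
  hg.mono_set (by
    rw [Set.uIcc_of_le hx.1, Set.uIcc_of_le zero_le_one]
    exact Set.Icc_subset_Icc_right hx.2)

theorem IntervalIntegrable.sin_mul (hg : IntervalIntegrable g volume 0 x) :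
    IntervalIntegrable (fun s => Real.sin (z * s) * g s) volume 0 x :=
  hg.continuousOn_mul (by fun_prop)

theorem IntervalIntegrable.cos_mul (hg : IntervalIntegrable g volume 0 x) :
    IntervalIntegrable (fun s => Real.cos (z * s) * g s) volume 0 x :=
  hg.continuousOn_mul (by fun_prop)

theorem integral_sin_mul_sub_mul (hg : IntervalIntegrable g volume 0 x) :
    ∫ s in (0 : ℝ)..x, Real.sin (z * (x - s)) * g s =
      Real.sin (z * x) * (∫ s in (0 : ℝ)..x, Real.cos (z * s) * g s) -
        Real.cos (z * x) * ∫ s in (0 : ℝ)..x, Real.sin (z * s) * g s := by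
  rw [← intervalIntegral.integral_const_mul, ← intervalIntegral.integral_const_mul,
    ← intervalIntegral.integral_sub (hg.cos_mul.const_mul _) (hg.sin_mul.const_mul _)]
  refine intervalIntegral.integral_congr fun s _ => ?_
  simp only [mul_sub, Real.sin_sub]
  ring

theorem integral_cos_mul_sub_mul (hg : IntervalIntegrable g volume 0 x) :
    ∫ s in (0 : ℝ)..x, Real.cos (z * (x - s)) * g s =
      Real.cos (z * x) * (∫ s in (0 : ℝ)..x, Real.cos (z * s) * g s) +
        Real.sin (z * x) * ∫ s in (0 : ℝ)..x, Real.sin (z * s) * g s := by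
  rw [← intervalIntegral.integral_const_mul, ← intervalIntegral.integral_const_mul,
    ← intervalIntegral.integral_add (hg.cos_mul.const_mul _) (hg.sin_mul.const_mul _)]
  refine intervalIntegral.integral_congr fun s _ => ?_
  simp only [mul_sub, Real.cos_sub]
  ring

/-- An integral against `|k| ≤ K` is at most `K ∫₀¹ |q|`. -/
theorem abs_integral_mul_le (hq : IntervalIntegrable q volume 0 1) (hx : x ∈ Set.Icc (0 : ℝ) 1)
    {k : ℝ → ℝ} {K : ℝ} (hk : ∀ s ∈ Set.Icc (0 : ℝ) 1, |k s| ≤ K) :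
    |∫ s in (0 : ℝ)..x, k s * q s| ≤ K * ∫ s in (0 : ℝ)..1, |q s| := by
  have hK : 0 ≤ K := (abs_nonneg _).trans (hk 0 ⟨le_rfl, zero_le_one⟩)
  calc |∫ s in (0 : ℝ)..x, k s * q s| ≤ ∫ s in (0 : ℝ)..x, K * |q s| := by
        refine intervalIntegral.norm_integral_le_of_norm_le (f := fun s => k s * q s) hx.1
          (ae_of_all _ fun s hs => ?_) ((hq.mono_right_Icc hx).abs.const_mul K)
        rw [Real.norm_eq_abs, abs_mul]
        exact mul_le_mul_of_nonneg_right (hk s ⟨hs.1.le, hs.2.trans hx.2⟩) (abs_nonneg _)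
    _ ≤ ∫ s in (0 : ℝ)..1, K * |q s| :=
        intervalIntegral.integral_mono_interval le_rfl hx.1 hx.2
          (ae_of_all _ fun s => by positivity) (hq.abs.const_mul K)
    _ = K * ∫ s in (0 : ℝ)..1, |q s| := intervalIntegral.integral_const_mul _ _

end Integrals

section Solutions

variable {z α β : ℝ} {q y : ℝ → ℝ}

theorem IsDuhamelSolution.eq_amplitudes (h : IsDuhamelSolution z q α β y)
    (hq : IntervalIntegrable q volume 0 1) {x : ℝ} (hx : x ∈ Set.Icc (0 : ℝ) 1) :
    y x = cosAmplitude z q α y x * Real.cos (z * x) +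
      sinAmplitude z q β y x * Real.sin (z * x) := by
  rw [h.eq x hx, integral_sin_mul_sub_mul
    ((intervalIntegrable_mul_of_continuousOn_Icc hq h.continuousOn).mono_right_Icc hx)]
  simp only [cosAmplitude, sinAmplitude]
  ring

theorem absolutelyContinuousOnInterval_const (c a b : ℝ) :
    AbsolutelyContinuousOnInterval (fun _ : ℝ => c) a b :=
  (LipschitzWith.const c).lipschitzOnWith.absolutelyContinuousOnInterval

theorem absolutelyContinuousOnInterval_cosAmplitude
    (hg : IntervalIntegrable (fun s => q s * y s) volume 0 1) :
    AbsolutelyContinuousOnInterval (cosAmplitude z q α y) 0 1 :=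
  (absolutelyContinuousOnInterval_const α 0 1).fun_sub
    ((hg.sin_mul.absolutelyContinuousOnInterval_intervalIntegral (by simp)).const_mul z⁻¹)

theorem absolutelyContinuousOnInterval_sinAmplitude
    (hg : IntervalIntegrable (fun s => q s * y s) volume 0 1) :
    AbsolutelyContinuousOnInterval (sinAmplitude z q β y) 0 1 :=
  (absolutelyContinuousOnInterval_const β 0 1).fun_add
    ((hg.cos_mul.absolutelyContinuousOnInterval_intervalIntegral (by simp)).const_mul z⁻¹)

theorem ae_hasDerivAt_cosAmplitude (hg : IntervalIntegrable (fun s => q s * y s) volume 0 1) :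
    ∀ᵐ x, x ∈ Set.uIcc (0 : ℝ) 1 → HasDerivAt (cosAmplitude z q α y)
      (-(z⁻¹ * (Real.sin (z * x) * (q x * y x)))) x := by
  filter_upwards [hg.sin_mul.ae_hasDerivAt_integral] with x hx hx'
  exact ((hx hx' 0 (by simp)).const_mul z⁻¹).const_sub α

theorem ae_hasDerivAt_sinAmplitude (hg : IntervalIntegrable (fun s => q s * y s) volume 0 1) :
    ∀ᵐ x, x ∈ Set.uIcc (0 : ℝ) 1 → HasDerivAt (sinAmplitude z q β y)
      (z⁻¹ * (Real.cos (z * x) * (q x * y x))) x := by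
  filter_upwards [hg.cos_mul.ae_hasDerivAt_integral] with x hx hx'
  exact ((hx hx' 0 (by simp)).const_mul z⁻¹).const_add β

/-- Constancy of the Wronskian, in terms of the amplitudes. -/
theorem IsDuhamelSolution.wronskian_eq {α₁ β₁ α₂ β₂ : ℝ} {y₁ y₂ : ℝ → ℝ}
    (h₁ : IsDuhamelSolution z q α₁ β₁ y₁) (h₂ : IsDuhamelSolution z q α₂ β₂ y₂)
    (hq : IntervalIntegrable q volume 0 1) :
    cosAmplitude z q α₁ y₁ 1 * sinAmplitude z q β₂ y₂ 1 -
      cosAmplitude z q α₂ y₂ 1 * sinAmplitude z q β₁ y₁ 1 = α₁ * β₂ - α₂ * β₁ := by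
  have hg₁ := intervalIntegrable_mul_of_continuousOn_Icc hq h₁.continuousOn
  have hg₂ := intervalIntegrable_mul_of_continuousOn_Icc hq h₂.continuousOn
  obtain ⟨C, hC⟩ := AbsolutelyContinuousOnInterval.const_of_ae_hasDerivAt_zero
    (((absolutelyContinuousOnInterval_cosAmplitude (z := z) (α := α₁) hg₁).fun_mul
      (absolutelyContinuousOnInterval_sinAmplitude (z := z) (β := β₂) hg₂)).fun_sub
    ((absolutelyContinuousOnInterval_cosAmplitude (z := z) (α := α₂) hg₂).fun_mul
      (absolutelyContinuousOnInterval_sinAmplitude (z := z) (β := β₁) hg₁))) (by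
    filter_upwards [ae_hasDerivAt_cosAmplitude (z := z) (α := α₁) hg₁,
      ae_hasDerivAt_sinAmplitude (z := z) (β := β₁) hg₁,
      ae_hasDerivAt_cosAmplitude (z := z) (α := α₂) hg₂,
      ae_hasDerivAt_sinAmplitude (z := z) (β := β₂) hg₂] with x ha₁ hb₁ ha₂ hb₂ hx
    have hx' : x ∈ Set.Icc (0 : ℝ) 1 := by rwa [Set.uIcc_of_le zero_le_one] at hx
    refine HasDerivAt.congr_deriv
      (((ha₁ hx).fun_mul (hb₂ hx)).fun_sub ((ha₂ hx).fun_mul (hb₁ hx))) ?_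
    have e₁ := h₁.eq_amplitudes hq hx'
    have e₂ := h₂.eq_amplitudes hq hx'
    linear_combination (-(z⁻¹ * q x * y₂ x)) * e₁ + z⁻¹ * q x * y₁ x * e₂)
  rw [hC 1 (by simp), ← hC 0 (by simp)]
  simp [cosAmplitude, sinAmplitude]

theorem abs_mul_cos_add_mul_sin_le (hαβ : |α| + |β| ≤ 1) (t : ℝ) :
    |α * Real.cos t + β * Real.sin t| ≤ 1 := by
  calc |α * Real.cos t + β * Real.sin t| ≤ |α| * |Real.cos t| + |β| * |Real.sin t| := by
        rw [← abs_mul, ← abs_mul]; exact abs_add_le _ _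
    _ ≤ |α| * 1 + |β| * 1 := by
        gcongr
        · exact Real.abs_cos_le_one t
        · exact Real.abs_sin_le_one t
    _ ≤ 1 := by linarith

/-- A solution differs from its free part by `z⁻¹ (sup |y|) ∫ |q|`. -/
theorem IsDuhamelSolution.abs_sub_le_of_bound (h : IsDuhamelSolution z q α β y)
    (hq : IntervalIntegrable q volume 0 1) (hz : 0 < z) {M : ℝ}
    (hM : ∀ s ∈ Set.Icc (0 : ℝ) 1, |y s| ≤ M) {x : ℝ} (hx : x ∈ Set.Icc (0 : ℝ) 1) :
    |y x - (α * Real.cos (z * x) + β * Real.sin (z * x))| ≤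
      z⁻¹ * (M * ∫ s in (0 : ℝ)..1, |q s|) := by
  rw [h.eq x hx, add_sub_cancel_left, abs_mul, abs_of_pos (inv_pos.2 hz)]
  refine mul_le_mul_of_nonneg_left ?_ (inv_pos.2 hz).le
  have := abs_integral_mul_le hq hx (k := fun s => Real.sin (z * (x - s)) * y s) (K := M)
    fun s hs => by
      rw [abs_mul]
      exact (mul_le_of_le_one_left (abs_nonneg _) (Real.abs_sin_le_one _)).trans (hM s hs)
  refine le_of_eq_of_le (congrArg abs ?_) this
  exact intervalIntegral.integral_congr fun s _ => by ring

theorem IsDuhamelSolution.abs_le_two (h : IsDuhamelSolution z q α β y)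
    (hq : IntervalIntegrable q volume 0 1) (hz : 0 < z) (hαβ : |α| + |β| ≤ 1)
    (hQ : 2 * ∫ s in (0 : ℝ)..1, |q s| ≤ z) {x : ℝ} (hx : x ∈ Set.Icc (0 : ℝ) 1) :
    |y x| ≤ 2 := by
  obtain ⟨x₀, hx₀, hmax⟩ := isCompact_Icc.exists_isMaxOn
    (Set.nonempty_Icc.2 (zero_le_one (α := ℝ))) h.continuousOn.abs
  have hM : ∀ s ∈ Set.Icc (0 : ℝ) 1, |y s| ≤ |y x₀| := fun s hs => hmax hs
  have h₁ := h.abs_sub_le_of_bound hq hz hM hx₀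
  have h₂ := abs_mul_cos_add_mul_sin_le hαβ (z * x₀)
  have h₃ : z⁻¹ * (|y x₀| * ∫ s in (0 : ℝ)..1, |q s|) ≤ |y x₀| / 2 := by
    rw [inv_mul_le_iff₀ hz]
    nlinarith [abs_nonneg (y x₀)]
  have h₄ := abs_sub_abs_le_abs_sub (y x₀) (α * Real.cos (z * x₀) + β * Real.sin (z * x₀))
  linarith [hM x hx]

/-- Replacing a solution by its free part in an integral against a bounded oscillating factor. -/
theorem IsDuhamelSolution.abs_integral_sub_le (h : IsDuhamelSolution z q α β y)
    (hq : IntervalIntegrable q volume 0 1) (hz : 0 < z) (hαβ : |α| + |β| ≤ 1)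
    (hQ : 2 * ∫ s in (0 : ℝ)..1, |q s| ≤ z) {k : ℝ → ℝ} (hkc : Continuous k)
    (hk : ∀ s, |k s| ≤ 1) :
    |(∫ s in (0 : ℝ)..1, k s * (q s * y s)) -
      ∫ s in (0 : ℝ)..1, k s * (q s * (α * Real.cos (z * s) + β * Real.sin (z * s)))| ≤
      2 * (∫ s in (0 : ℝ)..1, |q s|) ^ 2 / z := by
  have hfree : Continuous fun s => α * Real.cos (z * s) + β * Real.sin (z * s) := by fun_prop
  have hbd := abs_integral_mul_le hq (x := 1) (by simp)
    (k := fun s => k s * (y s - (α * Real.cos (z * s) + β * Real.sin (z * s))))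
    (K := z⁻¹ * (2 * ∫ s in (0 : ℝ)..1, |q s|)) fun s hs => by
      rw [abs_mul]
      exact (mul_le_of_le_one_left (abs_nonneg _) (hk s)).trans
        (h.abs_sub_le_of_bound hq hz (fun t ht => h.abs_le_two hq hz hαβ hQ ht) hs)
  rw [← intervalIntegral.integral_sub
    ((intervalIntegrable_mul_of_continuousOn_Icc hq h.continuousOn).continuousOn_mul
      hkc.continuousOn)
    ((intervalIntegrable_mul_of_continuousOn_Icc hq hfree.continuousOn).continuousOn_mul
      hkc.continuousOn)]
  convert hbd using 1
  · congr 1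
    exact intervalIntegral.integral_congr fun s _ => by ring
  · ring

end Solutions

section Oscillation

/-- Riemann-Lebesgue lemma on `[0, 1]`, in complex form. -/
theorem tendsto_integral_exp_mul_zero (q : ℝ → ℝ) :
    Tendsto
      (fun z : ℝ => ∫ s in (0 : ℝ)..1, Complex.exp (-(2 * z * s : ℝ) * Complex.I) * (q s : ℂ))
      atTop (nhds 0) := by
  have h := (Real.tendsto_integral_exp_smul_cocompact
    ((Set.Ioc (0 : ℝ) 1).indicator fun s => (q s : ℂ))).comp
    ((tendsto_id.atTop_div_const Real.pi_pos).mono_right atTop_le_cocompact)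
  refine h.congr fun z => ?_
  rw [intervalIntegral.integral_of_le zero_le_one, ← integral_indicator measurableSet_Ioc]
  refine integral_congr_ae (ae_of_all _ fun s => ?_)
  by_cases hs : s ∈ Set.Ioc (0 : ℝ) 1
  · simp only [hs, Set.indicator_of_mem, Circle.smul_def, Real.fourierChar_apply, smul_eq_mul, id]
    congr 2
    push_cast
    have : (Real.pi : ℂ) ≠ 0 := by exact_mod_cast Real.pi_ne_zero
    field_simp
  · simp [hs]

theorem intervalIntegrable_exp_mul {q : ℝ → ℝ} (hq : IntervalIntegrable q volume 0 1) (z : ℝ) :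
    IntervalIntegrable (fun s : ℝ => Complex.exp (-(2 * z * s : ℝ) * Complex.I) * (q s : ℂ))
      volume 0 1 := by
  have hq' : IntervalIntegrable (fun s => (q s : ℂ)) volume 0 1 := ⟨hq.1.ofReal, hq.2.ofReal⟩
  exact hq'.continuousOn_mul (by fun_prop)

theorem re_integral_exp_mul {q : ℝ → ℝ} (hq : IntervalIntegrable q volume 0 1) (z : ℝ) :
    (∫ s in (0 : ℝ)..1, Complex.exp (-(2 * z * s : ℝ) * Complex.I) * (q s : ℂ)).re =
      ∫ s in (0 : ℝ)..1, Real.cos (2 * z * s) * q s := by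
  have := Complex.reCLM.intervalIntegral_comp_comm (intervalIntegrable_exp_mul hq z)
  simp only [Complex.reCLM_apply] at this
  rw [← this]
  refine intervalIntegral.integral_congr fun s _ => ?_
  simp only [← Complex.ofReal_neg, Complex.re_mul_ofReal, Complex.exp_ofReal_mul_I_re,
    Real.cos_neg]

theorem im_integral_exp_mul {q : ℝ → ℝ} (hq : IntervalIntegrable q volume 0 1) (z : ℝ) :
    (∫ s in (0 : ℝ)..1, Complex.exp (-(2 * z * s : ℝ) * Complex.I) * (q s : ℂ)).im =
      -∫ s in (0 : ℝ)..1, Real.sin (2 * z * s) * q s := by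
  have := Complex.imCLM.intervalIntegral_comp_comm (intervalIntegrable_exp_mul hq z)
  simp only [Complex.imCLM_apply] at this
  rw [← this, ← intervalIntegral.integral_neg]
  refine intervalIntegral.integral_congr fun s _ => ?_
  simp only [← Complex.ofReal_neg, Complex.im_mul_ofReal, Complex.exp_ofReal_mul_I_im,
    Real.sin_neg, neg_mul]

theorem tendsto_integral_cos_mul_zero {q : ℝ → ℝ} (hq : IntervalIntegrable q volume 0 1) :
    Tendsto (fun z : ℝ => ∫ s in (0 : ℝ)..1, Real.cos (2 * z * s) * q s) atTop (nhds 0) := by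
  simpa only [Function.comp_def, re_integral_exp_mul hq, Complex.zero_re] using
    (Complex.continuous_re.tendsto 0).comp (tendsto_integral_exp_mul_zero q)

theorem tendsto_integral_sin_mul_zero {q : ℝ → ℝ} (hq : IntervalIntegrable q volume 0 1) :
    Tendsto (fun z : ℝ => ∫ s in (0 : ℝ)..1, Real.sin (2 * z * s) * q s) atTop (nhds 0) := by
  simpa only [Function.comp_def, im_integral_exp_mul hq, Complex.zero_im, neg_neg, neg_zero] using
    ((Complex.continuous_im.tendsto 0).comp (tendsto_integral_exp_mul_zero q)).neg

variable {a : ℝ} {V : ℝ → ℝ → ℝ} {Vinf : ℝ → ℝ}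

/-- Vanishing of integrals against bounded kernels passes from the `L¹` limit of a family of
potentials to the family. -/
theorem tendsto_integral_mul_zero_of_tendsto_L1
    (hVint : ∀ lam : ℝ, a < lam → IntervalIntegrable (V lam) volume 0 1)
    (hVinf : IntervalIntegrable Vinf volume 0 1)
    (hL1 : Tendsto (fun lam : ℝ => ∫ s in (0:ℝ)..1, |V lam s - Vinf s|) atTop (nhds 0))
    {k : ℝ → ℝ → ℝ} (hkc : ∀ lam, Continuous (k lam)) (hk : ∀ lam s, |k lam s| ≤ 1)
    (h : Tendsto (fun lam => ∫ s in (0 : ℝ)..1, k lam s * Vinf s) atTop (nhds 0)) :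
    Tendsto (fun lam => ∫ s in (0 : ℝ)..1, k lam s * V lam s) atTop (nhds 0) := by
  refine squeeze_zero_norm' ?_ (by simpa using hL1.add h.abs)
  filter_upwards [eventually_gt_atTop a] with lam hlam
  have hd := (hVint lam hlam).sub hVinf
  have hbd := abs_integral_mul_le hd (x := 1) (by simp) fun s _ => hk lam s
  have hsplit : ∫ s in (0 : ℝ)..1, k lam s * V lam s =
      (∫ s in (0 : ℝ)..1, k lam s * (V lam s - Vinf s)) + ∫ s in (0 : ℝ)..1, k lam s * Vinf s := by
    rw [← intervalIntegral.integral_add (hd.continuousOn_mul (hkc lam).continuousOn)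
      (hVinf.continuousOn_mul (hkc lam).continuousOn)]
    exact intervalIntegral.integral_congr fun s _ => by ring
  rw [one_mul] at hbd
  rw [hsplit, Real.norm_eq_abs]
  exact (abs_add_le _ _).trans (add_le_add_left hbd _)

theorem eventually_integral_abs_le
    (hVint : ∀ lam : ℝ, a < lam → IntervalIntegrable (V lam) volume 0 1)
    (hVinf : IntervalIntegrable Vinf volume 0 1)
    (hL1 : Tendsto (fun lam : ℝ => ∫ s in (0:ℝ)..1, |V lam s - Vinf s|) atTop (nhds 0)) :
    ∀ᶠ lam in atTop, ∫ s in (0 : ℝ)..1, |V lam s| ≤ 1 + ∫ s in (0 : ℝ)..1, |Vinf s| := by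
  filter_upwards [eventually_gt_atTop a, hL1.eventually (eventually_le_nhds zero_lt_one)]
    with lam hlam h1
  have hd := (hVint lam hlam).sub hVinf
  calc ∫ s in (0 : ℝ)..1, |V lam s| ≤ ∫ s in (0 : ℝ)..1, (|V lam s - Vinf s| + |Vinf s|) := by
        refine intervalIntegral.integral_mono_on zero_le_one (hVint lam hlam).abs
          (hd.abs.add hVinf.abs) fun s _ => ?_
        simpa using abs_add_le (V lam s - Vinf s) (Vinf s)
    _ = (∫ s in (0 : ℝ)..1, |V lam s - Vinf s|) + ∫ s in (0 : ℝ)..1, |Vinf s| :=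
        intervalIntegral.integral_add hd.abs hVinf.abs
    _ ≤ 1 + ∫ s in (0 : ℝ)..1, |Vinf s| := by linarith

end Oscillation

section AmplitudeBounds

variable {z α β : ℝ} {q y : ℝ → ℝ}

/-- A bound for `z` times the variation of the amplitudes over a period. -/
noncomputable def amplitudeBound (z : ℝ) (q : ℝ → ℝ) : ℝ :=
  |∫ s in (0 : ℝ)..1, q s| + |∫ s in (0 : ℝ)..1, Real.cos (2 * z * s) * q s| +
    |∫ s in (0 : ℝ)..1, Real.sin (2 * z * s) * q s| + 2 * (∫ s in (0 : ℝ)..1, |q s|) ^ 2 / z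

theorem integral_sin_mul_free (hq : IntervalIntegrable q volume 0 1) :
    ∫ s in (0 : ℝ)..1, Real.sin (z * s) * (q s * (α * Real.cos (z * s) + β * Real.sin (z * s))) =
      α / 2 * (∫ s in (0 : ℝ)..1, Real.sin (2 * z * s) * q s) +
        β / 2 * ((∫ s in (0 : ℝ)..1, q s) - ∫ s in (0 : ℝ)..1, Real.cos (2 * z * s) * q s) := by
  rw [← intervalIntegral.integral_sub hq hq.cos_mul, ← intervalIntegral.integral_const_mul,
    ← intervalIntegral.integral_const_mul, ← intervalIntegral.integral_add
      (hq.sin_mul.const_mul _) ((hq.sub hq.cos_mul).const_mul _)]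
  refine intervalIntegral.integral_congr fun s _ => ?_
  simp only [mul_assoc, Real.sin_two_mul, Real.cos_two_mul']
  linear_combination (β * q s / 2) * Real.sin_sq_add_cos_sq (z * s)

theorem integral_cos_mul_free (hq : IntervalIntegrable q volume 0 1) :
    ∫ s in (0 : ℝ)..1, Real.cos (z * s) * (q s * (α * Real.cos (z * s) + β * Real.sin (z * s))) =
      α / 2 * ((∫ s in (0 : ℝ)..1, q s) + ∫ s in (0 : ℝ)..1, Real.cos (2 * z * s) * q s) +
        β / 2 * ∫ s in (0 : ℝ)..1, Real.sin (2 * z * s) * q s := by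
  rw [← intervalIntegral.integral_add hq hq.cos_mul, ← intervalIntegral.integral_const_mul,
    ← intervalIntegral.integral_const_mul, ← intervalIntegral.integral_add
      ((hq.add hq.cos_mul).const_mul _) (hq.sin_mul.const_mul _)]
  refine intervalIntegral.integral_congr fun s _ => ?_
  simp only [mul_assoc, Real.sin_two_mul, Real.cos_two_mul']
  linear_combination (α * q s / 2) * Real.sin_sq_add_cos_sq (z * s)

theorem abs_combination_le (hαβ : |α| + |β| ≤ 1) (u v : ℝ) :
    |α / 2 * u + β / 2 * v| ≤ |u| + |v| := by
  have hu : |α / 2 * u| ≤ |u| := by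
    rw [abs_mul]
    refine mul_le_of_le_one_left (abs_nonneg _) ?_
    rw [abs_div, abs_two]
    linarith [abs_nonneg β]
  have hv : |β / 2 * v| ≤ |v| := by
    rw [abs_mul]
    refine mul_le_of_le_one_left (abs_nonneg _) ?_
    rw [abs_div, abs_two]
    linarith [abs_nonneg α]
  exact (abs_add_le _ _).trans (add_le_add hu hv)

theorem IsDuhamelSolution.abs_cosAmplitude_sub_le (h : IsDuhamelSolution z q α β y)
    (hq : IntervalIntegrable q volume 0 1) (hz : 0 < z) (hαβ : |α| + |β| ≤ 1)
    (hQ : 2 * ∫ s in (0 : ℝ)..1, |q s| ≤ z) :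
    |cosAmplitude z q α y 1 - α| ≤ amplitudeBound z q / z := by
  have h₁ := h.abs_integral_sub_le hq hz hαβ hQ (k := fun s => Real.sin (z * s)) (by fun_prop)
    fun s => Real.abs_sin_le_one _
  rw [integral_sin_mul_free hq] at h₁
  have h₂ := abs_combination_le hαβ (∫ s in (0 : ℝ)..1, Real.sin (2 * z * s) * q s)
    ((∫ s in (0 : ℝ)..1, q s) - ∫ s in (0 : ℝ)..1, Real.cos (2 * z * s) * q s)
  have h₃ := abs_sub (∫ s in (0 : ℝ)..1, q s) (∫ s in (0 : ℝ)..1, Real.cos (2 * z * s) * q s)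
  have h₄ := (abs_sub_abs_le_abs_sub _ _).trans h₁
  rw [cosAmplitude, sub_sub_cancel_left, abs_neg, abs_mul, abs_of_pos (inv_pos.2 hz),
    div_eq_inv_mul]
  refine mul_le_mul_of_nonneg_left ?_ (inv_pos.2 hz).le
  rw [amplitudeBound]
  linarith

theorem IsDuhamelSolution.abs_sinAmplitude_sub_le (h : IsDuhamelSolution z q α β y)
    (hq : IntervalIntegrable q volume 0 1) (hz : 0 < z) (hαβ : |α| + |β| ≤ 1)
    (hQ : 2 * ∫ s in (0 : ℝ)..1, |q s| ≤ z) :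
    |sinAmplitude z q β y 1 - β| ≤ amplitudeBound z q / z := by
  have h₁ := h.abs_integral_sub_le hq hz hαβ hQ (k := fun s => Real.cos (z * s)) (by fun_prop)
    fun s => Real.abs_cos_le_one _
  rw [integral_cos_mul_free hq] at h₁
  have h₂ := abs_combination_le hαβ
    ((∫ s in (0 : ℝ)..1, q s) + ∫ s in (0 : ℝ)..1, Real.cos (2 * z * s) * q s)
    (∫ s in (0 : ℝ)..1, Real.sin (2 * z * s) * q s)
  have h₃ := abs_add_le (∫ s in (0 : ℝ)..1, q s) (∫ s in (0 : ℝ)..1, Real.cos (2 * z * s) * q s)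
  have h₄ := (abs_sub_abs_le_abs_sub _ _).trans h₁
  rw [sinAmplitude, add_sub_cancel_left, abs_mul, abs_of_pos (inv_pos.2 hz), div_eq_inv_mul]
  refine mul_le_mul_of_nonneg_left ?_ (inv_pos.2 hz).le
  rw [amplitudeBound]
  linarith

theorem tendsto_amplitudeBound {a : ℝ} {V : ℝ → ℝ → ℝ} {Vinf : ℝ → ℝ}
    (hVint : ∀ lam : ℝ, a < lam → IntervalIntegrable (V lam) volume 0 1)
    (hVinf : IntervalIntegrable Vinf volume 0 1)
    (hL1 : Tendsto (fun lam : ℝ => ∫ s in (0:ℝ)..1, |V lam s - Vinf s|) atTop (nhds 0))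
    (havg : Tendsto (fun lam : ℝ => ∫ s in (0:ℝ)..1, V lam s) atTop (nhds 0)) :
    Tendsto (fun lam => amplitudeBound (Real.sqrt lam) (V lam)) atTop (nhds 0) := by
  have hc := tendsto_integral_mul_zero_of_tendsto_L1 hVint hVinf hL1
    (k := fun lam s => Real.cos (2 * Real.sqrt lam * s)) (fun _ => by fun_prop)
    (fun _ _ => Real.abs_cos_le_one _)
    ((tendsto_integral_cos_mul_zero hVinf).comp Real.tendsto_sqrt_atTop)
  have hs := tendsto_integral_mul_zero_of_tendsto_L1 hVint hVinf hL1
    (k := fun lam s => Real.sin (2 * Real.sqrt lam * s)) (fun _ => by fun_prop)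
    (fun _ _ => Real.abs_sin_le_one _)
    ((tendsto_integral_sin_mul_zero hVinf).comp Real.tendsto_sqrt_atTop)
  have hQ : Tendsto (fun lam => 2 * (∫ s in (0 : ℝ)..1, |V lam s|) ^ 2 / Real.sqrt lam)
      atTop (nhds 0) := by
    refine squeeze_zero' (Eventually.of_forall fun lam => by positivity) ?_
      (tendsto_const_nhds (x := 2 * (1 + ∫ s in (0 : ℝ)..1, |Vinf s|) ^ 2).div_atTop
        Real.tendsto_sqrt_atTop)
    filter_upwards [eventually_integral_abs_le hVint hVinf hL1] with lam h
    have : 0 ≤ ∫ s in (0 : ℝ)..1, |V lam s| :=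
      intervalIntegral.integral_nonneg zero_le_one fun _ _ => abs_nonneg _
    gcongr
  simpa [amplitudeBound] using ((havg.abs.add hc.abs).add hs.abs).add hQ

end AmplitudeBounds

/-- If a unimodular matrix close to the identity, composed with a rotation, has trace `± 2`, then
the angle of the rotation is close to a multiple of `π`. -/
theorem abs_sin_le_of_sq_half_trace_eq_one {t a₁ b₁ a₂ b₂ q : ℝ} (hq : q ≤ 1)
    (ha₁ : |a₁ - 1| ≤ q) (hb₁ : |b₁| ≤ q) (ha₂ : |a₂| ≤ q) (hb₂ : |b₂ - 1| ≤ q)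
    (hdet : a₁ * b₂ - a₂ * b₁ = 1)
    (htr : (((a₁ + b₂) * Real.cos t + (b₁ - a₂) * Real.sin t) / 2) ^ 2 = 1) :
    |Real.sin t| ≤ 5 * q := by
  have hq0 : 0 ≤ q := (abs_nonneg _).trans hb₁
  have hs1 := Real.abs_sin_le_one t
  have hc1 := Real.abs_cos_le_one t
  have hs0 := abs_nonneg (Real.sin t)
  set r := (a₁ + b₂ - 2) * Real.cos t + (b₁ - a₂) * Real.sin t with hr
  have hdiag : |a₁ + b₂ - 2| ≤ 2 * q ^ 2 := by
    have : a₁ + b₂ - 2 = a₂ * b₁ - (a₁ - 1) * (b₂ - 1) := by linear_combination hdet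
    rw [this]
    refine (abs_sub _ _).trans ?_
    rw [abs_mul, abs_mul]
    nlinarith [mul_le_mul ha₂ hb₁ (abs_nonneg _) hq0, mul_le_mul ha₁ hb₂ (abs_nonneg _) hq0]
  have hoff : |b₁ - a₂| ≤ 2 * q := (abs_sub _ _).trans (by linarith)
  have hrle : |r| ≤ 2 * q ^ 2 + 2 * q * |Real.sin t| := by
    refine (abs_add_le _ _).trans ?_
    rw [abs_mul, abs_mul]
    exact add_le_add ((mul_le_of_le_one_right (abs_nonneg _) hc1).trans hdiag) (by gcongr)
  have hr4 : |r| ≤ 4 := by nlinarith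
  have hsq : 4 * Real.sin t ^ 2 = 4 * (Real.cos t * r) + r ^ 2 := by
    rw [hr]
    linear_combination -4 * htr + 4 * Real.sin_sq_add_cos_sq t
  have hcr : Real.cos t * r ≤ |r| := by
    refine (le_abs_self _).trans ?_
    rw [abs_mul]
    exact mul_le_of_le_one_left (abs_nonneg _) hc1
  have hr2 : r ^ 2 ≤ 4 * |r| := by
    rw [← sq_abs]
    nlinarith [abs_nonneg r]
  rw [← sq_abs] at hsq
  by_contra! hlt
  nlinarith

/-- If `|sin z| ≤ 5 η / z`, then `z ^ 2` is within `32 η` of some `(π n) ^ 2`, `n ≥ 1`. -/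
theorem exists_abs_sq_sub_le_of_abs_sin_le {z η : ℝ} (hz : 4 ≤ z) (hη : 0 ≤ η)
    (hsin : |Real.sin z| ≤ 5 * (η / z)) :
    ∃ n : ℕ, 1 ≤ n ∧ |z ^ 2 - (Real.pi * n) ^ 2| ≤ 32 * η := by
  have hπ := Real.pi_pos
  have hπ4 := Real.pi_lt_d2
  have hz0 : 0 < z := by linarith
  have hround : |z - round (z / Real.pi) * Real.pi| ≤ Real.pi / 2 := by
    have := abs_sub_round (z / Real.pi)
    have e : z - round (z / Real.pi) * Real.pi =
        (z / Real.pi - round (z / Real.pi)) * Real.pi := by field_simp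
    rw [e, abs_mul, abs_of_pos hπ]
    nlinarith
  set m : ℤ := round (z / Real.pi) with hm
  have hmpos : 0 < m := by
    have h1 := (abs_le.1 hround).2
    have : (0 : ℝ) < m := by
      by_contra! h0
      nlinarith
    exact_mod_cast this
  obtain ⟨n, hn⟩ := Int.eq_ofNat_of_zero_le hmpos.le
  have hmn : (m : ℝ) = n := by rw [hn]; simp
  refine ⟨n, by omega, ?_⟩
  have hsin' : |Real.sin (z - m * Real.pi)| = |Real.sin z| := by
    rw [Real.sin_sub_int_mul_pi, abs_mul]
    simp [abs_zpow]
  have hjordan : 2 / Real.pi * |z - m * Real.pi| ≤ |Real.sin z| := by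
    rw [← hsin']
    exact Real.mul_abs_le_abs_sin hround
  rw [hmn] at hjordan hround
  have hd : |z - n * Real.pi| ≤ 8 * (η / z) := by
    have hηz : 0 ≤ η / z := by positivity
    have e : |z - n * Real.pi| = Real.pi / 2 * (2 / Real.pi * |z - n * Real.pi|) := by field_simp
    rw [e]
    nlinarith
  have hsum : |z + n * Real.pi| ≤ 4 * z := by
    have h0 : 0 ≤ z + n * Real.pi := by positivity
    rw [abs_of_nonneg h0]
    linarith [(abs_le.1 hround).1]
  calc |z ^ 2 - (Real.pi * n) ^ 2| = |z - n * Real.pi| * |z + n * Real.pi| := by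
        rw [← abs_mul]; congr 1; ring
    _ ≤ 8 * (η / z) * (4 * z) := by gcongr
    _ = 32 * η := by field_simp; ring

theorem two_periodic_eigenvalue_asymptotics
    (a : ℝ) (V : ℝ → ℝ → ℝ)
    (hVint : ∀ lam : ℝ, a < lam → IntervalIntegrable (V lam) volume 0 1)
    (Vinf : ℝ → ℝ) (hVinf : IntervalIntegrable Vinf volume 0 1)
    (hL1 : Tendsto (fun lam : ℝ => ∫ s in (0:ℝ)..1, |V lam s - Vinf s|)
      atTop (nhds 0))
    (havg : Tendsto (fun lam : ℝ => ∫ s in (0:ℝ)..1, V lam s) atTop (nhds 0))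
    (θ φ φd : ℝ → ℝ → ℝ)
    (hθc : ∀ lam : ℝ, max a 0 < lam → ContinuousOn (θ lam) (Set.Icc (0:ℝ) 1))
    (hφc : ∀ lam : ℝ, max a 0 < lam → ContinuousOn (φ lam) (Set.Icc (0:ℝ) 1))
    (hθ : ∀ lam : ℝ, max a 0 < lam → ∀ x ∈ Set.Icc (0:ℝ) 1,
      θ lam x = Real.cos (Real.sqrt lam * x) +
        ∫ s in (0:ℝ)..x,
          (Real.sin (Real.sqrt lam * (x - s)) / Real.sqrt lam) * V lam s * θ lam s)
    (hφ : ∀ lam : ℝ, max a 0 < lam → ∀ x ∈ Set.Icc (0:ℝ) 1,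
      φ lam x = Real.sin (Real.sqrt lam * x) / Real.sqrt lam +
        ∫ s in (0:ℝ)..x,
          (Real.sin (Real.sqrt lam * (x - s)) / Real.sqrt lam) * V lam s * φ lam s)
    (hφd : ∀ lam : ℝ, max a 0 < lam → ∀ x ∈ Set.Icc (0:ℝ) 1,
      φd lam x = Real.cos (Real.sqrt lam * x) +
        ∫ s in (0:ℝ)..x, Real.cos (Real.sqrt lam * (x - s)) * V lam s * φ lam s) :
    ∀ ε > 0, ∃ Λ : ℝ, a < Λ ∧ ∀ lam : ℝ, Λ < lam →
      ((θ lam 1 + φd lam 1) / 2) ^ 2 = 1 →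
      ∃ n : ℕ, 1 ≤ n ∧ |lam - (Real.pi * n) ^ 2| < ε := by
  intro ε hε
  set η := min 1 (ε / 64) with hη
  have hη0 : 0 < η := by positivity
  have hη1 : η ≤ 1 := min_le_left _ _
  have hηε : η ≤ ε / 64 := min_le_right _ _
  obtain ⟨Λ, hΛ⟩ := eventually_atTop.1
    ((tendsto_amplitudeBound hVint hVinf hL1 havg).eventually (eventually_le_nhds hη0) |>.and
      ((eventually_integral_abs_le hVint hVinf hL1).and
        (Real.tendsto_sqrt_atTop.eventually_ge_atTop
          (max 4 (2 * (1 + ∫ s in (0 : ℝ)..1, |Vinf s|))))))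
  refine ⟨max Λ (max a 0) + 1, ?_, fun lam hlam htr => ?_⟩
  · linarith [le_max_right Λ (max a 0), le_max_left a 0]
  have hΛlam : Λ ≤ lam := by linarith [le_max_left Λ (max a 0)]
  have ha0 : max a 0 < lam := by linarith [le_max_right Λ (max a 0)]
  have hlam0 : 0 < lam := (le_max_right a 0).trans_lt ha0
  obtain ⟨hbound, hQ', hbig⟩ := hΛ lam hΛlam
  have hq := hVint lam ((le_max_left a 0).trans_lt ha0)
  have hθs := hθ lam ha0
  have hφs := hφ lam ha0
  have hφd1 := hφd lam ha0 1 (by simp)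
  have hlamsq : lam = Real.sqrt lam ^ 2 := (Real.sq_sqrt hlam0.le).symm
  set z := Real.sqrt lam with hzdef
  have hz4 : 4 ≤ z := (le_max_left _ _).trans hbig
  have hz0 : 0 < z := by linarith
  have hQ : 2 * ∫ s in (0 : ℝ)..1, |V lam s| ≤ z := by
    linarith [(le_max_right 4 (2 * (1 + ∫ s in (0 : ℝ)..1, |Vinf s|))).trans hbig]
  have h₁ : IsDuhamelSolution z (V lam) 1 0 (θ lam) := by
    refine ⟨hθc lam ha0, fun x hx => ?_⟩
    rw [hθs x hx, ← intervalIntegral.integral_const_mul, one_mul, zero_mul, add_zero]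
    congr 1
    exact intervalIntegral.integral_congr fun s _ => by ring
  have h₂ : IsDuhamelSolution z (V lam) 0 1 (fun x => z * φ lam x) := by
    refine ⟨continuousOn_const.mul (hφc lam ha0), fun x hx => ?_⟩
    rw [hφs x hx, ← intervalIntegral.integral_const_mul, one_mul, zero_mul, zero_add, mul_add,
      mul_div_cancel₀ _ hz0.ne', ← intervalIntegral.integral_const_mul]
    congr 1
    refine intervalIntegral.integral_congr fun s _ => ?_
    field_simp
  have hder : φd lam 1 = sinAmplitude z (V lam) 1 (fun x => z * φ lam x) 1 * Real.cos z -
      cosAmplitude z (V lam) 0 (fun x => z * φ lam x) 1 * Real.sin z := by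
    have hg := intervalIntegrable_mul_of_continuousOn_Icc hq h₂.continuousOn
    have e : ∫ s in (0 : ℝ)..1, Real.cos (z * (1 - s)) * V lam s * φ lam s =
        z⁻¹ * ∫ s in (0 : ℝ)..1, Real.cos (z * (1 - s)) * (V lam s * (z * φ lam s)) := by
      rw [← intervalIntegral.integral_const_mul]
      refine intervalIntegral.integral_congr fun s _ => ?_
      field_simp
    rw [hφd1, e, integral_cos_mul_sub_mul hg, mul_one]
    simp only [sinAmplitude, cosAmplitude]
    ring
  have hval := h₁.eq_amplitudes hq (x := 1) (by simp)
  rw [mul_one] at hval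
  rw [hval, hder] at htr
  have hdet := h₁.wronskian_eq h₂ hq
  have hqle : amplitudeBound z (V lam) / z ≤ η / z := by gcongr
  have hηz1 : η / z ≤ 1 := by rw [div_le_one hz0]; linarith
  have ha₁ := (h₁.abs_cosAmplitude_sub_le hq hz0 (by simp) hQ).trans hqle
  have hb₁ := (h₁.abs_sinAmplitude_sub_le hq hz0 (by simp) hQ).trans hqle
  have ha₂ := (h₂.abs_cosAmplitude_sub_le hq hz0 (by simp) hQ).trans hqle
  have hb₂ := (h₂.abs_sinAmplitude_sub_le hq hz0 (by simp) hQ).trans hqle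
  rw [sub_zero] at hb₁ ha₂
  have hsin := abs_sin_le_of_sq_half_trace_eq_one (t := z) hηz1 ha₁ hb₁ ha₂ hb₂
    (by rw [hdet]; ring) (by linear_combination htr)
  obtain ⟨n, hn, hle⟩ := exists_abs_sq_sub_le_of_abs_sin_le hz4 hη0.le hsin
  refine ⟨n, hn, ?_⟩
  rw [hlamsq]
  linarith
end

section
/- Fix k ∈ (0,π). Let a ∈ ℝ and for each real λ > a let V(·,λ) : [0,1] → ℝ be Lebesgue integrable. Assume ∫₀¹ |V(s,λ)| ds = o(λ^{1/4}) and ∫₀¹ V(s,λ) ds → 0 as λ → +∞. For real λ > max(a,0) let Δ(λ) denote the Lyapunov function of the Hill equation −y'' + V(·,λ) y = λ y. Then for every ε > 0 there exists Λ > a such that every real λ > Λ with Δ(λ) = cos k satisfies |λ − (2πn + k)²| < ε or |λ − (2πn − k)²| < ε for some integer n ≥ 1. (That is, the real quasi-periodic eigenvalues λ_m(k) satisfy λ_m(k) = λ_m^o(k) + o(1) as m → ∞, where λ_m^o(k) are the unperturbed eigenvalues (2πn ± k)².) -/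
open MeasureTheory Filter

/-- A weighted integral of `V` over `[0, x] ⊆ [0, 1]` is at most the bound of the weight times
the `L¹` norm of `V`. -/
lemma abs_integral_mul_mul_le {V K h : ℝ → ℝ} (hV : IntervalIntegrable V volume 0 1)
    {c x : ℝ} (hx : x ∈ Set.Icc (0:ℝ) 1) (hc : 0 ≤ c)
    (hb : ∀ s ∈ Set.Icc (0:ℝ) 1, |K s * h s| ≤ c) :
    |∫ s in (0:ℝ)..x, K s * V s * h s| ≤ c * ∫ s in (0:ℝ)..1, |V s| := by
  have hVa : IntervalIntegrable (fun s => c * |V s|) volume 0 1 := hV.abs.const_mul c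
  calc |∫ s in (0:ℝ)..x, K s * V s * h s| ≤ ∫ s in (0:ℝ)..x, c * |V s| := by
        rw [← Real.norm_eq_abs]
        refine intervalIntegral.norm_integral_le_of_norm_le hx.1 ?_ ?_
        · refine Eventually.of_forall fun s hs => ?_
          have := hb s ⟨hs.1.le, hs.2.trans hx.2⟩
          rw [Real.norm_eq_abs, show K s * V s * h s = K s * h s * V s by ring, abs_mul]
          gcongr
        · refine hVa.mono_set ?_
          rw [Set.uIcc_of_le hx.1, Set.uIcc_of_le zero_le_one]
          exact Set.Icc_subset_Icc_right hx.2
    _ ≤ ∫ s in (0:ℝ)..1, c * |V s| := by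
        refine intervalIntegral.integral_mono_interval le_rfl hx.1 hx.2 ?_ hVa
        exact Eventually.of_forall fun s => by positivity
    _ = c * ∫ s in (0:ℝ)..1, |V s| := intervalIntegral.integral_const_mul _ _

/-- A solution of the Volterra equation with kernel `sin (z (x - s)) / z * V s` is close to its
inhomogeneous term once `z` dominates the `L¹` norm of `V`. -/
lemma abs_sub_le_of_volterra {V f g : ℝ → ℝ} (hV : IntervalIntegrable V volume 0 1)
    {z B : ℝ} (hz : 0 < z) (hN : ∫ s in (0:ℝ)..1, |V s| ≤ z / 2)
    (hf : ContinuousOn f (Set.Icc (0:ℝ) 1)) (hg : ∀ x ∈ Set.Icc (0:ℝ) 1, |g x| ≤ B)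
    (hfg : ∀ x ∈ Set.Icc (0:ℝ) 1,
      f x = g x + ∫ s in (0:ℝ)..x, Real.sin (z * (x - s)) / z * V s * f s) :
    ∀ x ∈ Set.Icc (0:ℝ) 1, |f x - g x| ≤ 2 * B / z * ∫ s in (0:ℝ)..1, |V s| := by
  set N := ∫ s in (0:ℝ)..1, |V s| with hNdef
  have hN0 : 0 ≤ N := intervalIntegral.integral_nonneg zero_le_one fun s _ => abs_nonneg _
  obtain ⟨x₀, hx₀, hmax⟩ := isCompact_Icc.exists_isMaxOn
    (Set.nonempty_Icc.2 (zero_le_one (α := ℝ))) hf.abs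
  set M := |f x₀| with hM
  have hM0 : 0 ≤ M := abs_nonneg _
  have key : ∀ x ∈ Set.Icc (0:ℝ) 1, |f x - g x| ≤ M / z * N := by
    intro x hx
    rw [hfg x hx, add_sub_cancel_left]
    refine abs_integral_mul_mul_le (K := fun s => Real.sin (z * (x - s)) / z) hV hx
      (by positivity) fun s hs => ?_
    rw [abs_mul, abs_div, abs_of_pos hz, div_mul_eq_mul_div]
    gcongr
    calc |Real.sin (z * (x - s))| * |f s| ≤ 1 * M := by
          gcongr
          · exact Real.abs_sin_le_one _
          · exact hmax hs
      _ = M := one_mul M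
  have hMN : M / z * N ≤ M / 2 := by
    calc M / z * N ≤ M / z * (z / 2) := by gcongr
      _ = M / 2 := by field_simp
  have hMB : M ≤ 2 * B := by
    have h₁ := key x₀ hx₀
    have h₂ := hg x₀ hx₀
    have h₃ := abs_sub_abs_le_abs_sub (f x₀) (g x₀)
    linarith
  intro x hx
  refine (key x hx).trans ?_
  gcongr

/-- First-order expansion of the Lyapunov function at frequency `z`. -/
lemma abs_lyapunov_sub_le {V θ φ : ℝ → ℝ} {φd₁ : ℝ} (hV : IntervalIntegrable V volume 0 1)
    {z : ℝ} (hz : 0 < z) (hN : ∫ s in (0:ℝ)..1, |V s| ≤ z / 2)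
    (hθc : ContinuousOn θ (Set.Icc (0:ℝ) 1)) (hφc : ContinuousOn φ (Set.Icc (0:ℝ) 1))
    (hθ : ∀ x ∈ Set.Icc (0:ℝ) 1,
      θ x = Real.cos (z * x) + ∫ s in (0:ℝ)..x, Real.sin (z * (x - s)) / z * V s * θ s)
    (hφ : ∀ x ∈ Set.Icc (0:ℝ) 1,
      φ x = Real.sin (z * x) / z + ∫ s in (0:ℝ)..x, Real.sin (z * (x - s)) / z * V s * φ s)
    (hφd : φd₁ = Real.cos z + ∫ s in (0:ℝ)..1, Real.cos (z * (1 - s)) * V s * φ s) :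
    |(θ 1 + φd₁) / 2 - (Real.cos z + Real.sin z / (2 * z) * ∫ s in (0:ℝ)..1, V s)| ≤
      2 * (∫ s in (0:ℝ)..1, |V s|) ^ 2 / z ^ 2 := by
  have hN0 : 0 ≤ ∫ s in (0:ℝ)..1, |V s| :=
    intervalIntegral.integral_nonneg zero_le_one fun s _ => abs_nonneg _
  have h1 : (1:ℝ) ∈ Set.Icc (0:ℝ) 1 := ⟨zero_le_one, le_rfl⟩
  have hθe := abs_sub_le_of_volterra (B := 1) hV hz hN hθc
    (fun x _ => Real.abs_cos_le_one _) hθ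
  have hφe := abs_sub_le_of_volterra (B := 1 / z) hV hz hN hφc (fun x _ => by
    rw [abs_div, abs_of_pos hz]
    gcongr
    exact Real.abs_sin_le_one _) hφ
  set N := ∫ s in (0:ℝ)..1, |V s| with hNdef
  have integrable : ∀ {K h : ℝ → ℝ}, Continuous K → ContinuousOn h (Set.Icc (0:ℝ) 1) →
      IntervalIntegrable (fun s => K s * V s * h s) volume 0 1 := fun hK hh =>
    (hV.continuousOn_mul hK.continuousOn).mul_continuousOn
      (by rwa [Set.uIcc_of_le zero_le_one])
  have hS : Continuous fun s => Real.sin (z * (1 - s)) / z := by fun_prop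
  have hC : Continuous fun s => Real.cos (z * (1 - s)) := by fun_prop
  have hcos : Continuous fun s => Real.cos (z * s) := by fun_prop
  have hsin : Continuous fun s => Real.sin (z * s) / z := by fun_prop
  have hEθ : |∫ s in (0:ℝ)..1, Real.sin (z * (1 - s)) / z * V s * (θ s - Real.cos (z * s))| ≤
      1 / z * (2 * 1 / z * N) * N := by
    refine abs_integral_mul_mul_le (K := fun s => Real.sin (z * (1 - s)) / z)
      (h := fun s => θ s - Real.cos (z * s)) hV h1 (by positivity) fun s hs => ?_
    rw [abs_mul, abs_div, abs_of_pos hz]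
    gcongr
    · exact Real.abs_sin_le_one _
    · exact hθe s hs
  have hEφ : |∫ s in (0:ℝ)..1, Real.cos (z * (1 - s)) * V s * (φ s - Real.sin (z * s) / z)| ≤
      1 * (2 * (1 / z) / z * N) * N := by
    refine abs_integral_mul_mul_le (K := fun s => Real.cos (z * (1 - s)))
      (h := fun s => φ s - Real.sin (z * s) / z) hV h1 (by positivity) fun s hs => ?_
    rw [abs_mul]
    gcongr
    · exact Real.abs_cos_le_one _
    · exact hφe s hs
  have hlead : (∫ s in (0:ℝ)..1, Real.sin (z * (1 - s)) / z * V s * Real.cos (z * s)) +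
      (∫ s in (0:ℝ)..1, Real.cos (z * (1 - s)) * V s * (Real.sin (z * s) / z)) =
      Real.sin z / z * ∫ s in (0:ℝ)..1, V s := by
    rw [← intervalIntegral.integral_add (integrable hS hcos.continuousOn)
      (integrable hC hsin.continuousOn), ← intervalIntegral.integral_const_mul]
    refine intervalIntegral.integral_congr fun s _ => ?_
    have : Real.sin z = Real.sin (z * (1 - s) + z * s) := by ring_nf
    simp only [this, Real.sin_add]
    ring
  have hdθ : (∫ s in (0:ℝ)..1, Real.sin (z * (1 - s)) / z * V s * (θ s - Real.cos (z * s))) =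
      (∫ s in (0:ℝ)..1, Real.sin (z * (1 - s)) / z * V s * θ s) -
      ∫ s in (0:ℝ)..1, Real.sin (z * (1 - s)) / z * V s * Real.cos (z * s) := by
    rw [← intervalIntegral.integral_sub (integrable hS hθc) (integrable hS hcos.continuousOn)]
    simp only [mul_sub]
  have hdφ : (∫ s in (0:ℝ)..1, Real.cos (z * (1 - s)) * V s * (φ s - Real.sin (z * s) / z)) =
      (∫ s in (0:ℝ)..1, Real.cos (z * (1 - s)) * V s * φ s) -
      ∫ s in (0:ℝ)..1, Real.cos (z * (1 - s)) * V s * (Real.sin (z * s) / z) := by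
    rw [← intervalIntegral.integral_sub (integrable hC hφc) (integrable hC hsin.continuousOn)]
    simp only [mul_sub]
  have hθ1 := hθ 1 h1
  rw [mul_one] at hθ1
  have hdecomp : (θ 1 + φd₁) / 2 -
      (Real.cos z + Real.sin z / (2 * z) * ∫ s in (0:ℝ)..1, V s) =
      ((∫ s in (0:ℝ)..1, Real.sin (z * (1 - s)) / z * V s * (θ s - Real.cos (z * s))) +
      ∫ s in (0:ℝ)..1, Real.cos (z * (1 - s)) * V s * (φ s - Real.sin (z * s) / z)) / 2 := by
    have : Real.sin z / (2 * z) * (∫ s in (0:ℝ)..1, V s) =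
        Real.sin z / z * (∫ s in (0:ℝ)..1, V s) / 2 := by ring
    rw [this, ← hlead, hdθ, hdφ, hφd, hθ1]
    ring
  rw [hdecomp, abs_div, abs_two, div_le_iff₀ two_pos]
  refine (abs_add_le _ _).trans ((add_le_add hEθ hEφ).trans (le_of_eq ?_))
  field_simp
  ring

/-- The inverse cosine is Lipschitz at `cos k` for `k ∈ (0, π)`. -/
lemma exists_abs_arccos_sub_le {k : ℝ} (hk : k ∈ Set.Ioo 0 Real.pi) :
    ∃ C > 0, ∃ η > 0, ∀ y, |y - Real.cos k| < η →
      |Real.arccos y - k| ≤ C * |y - Real.cos k| := by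
  have hsin : 0 < Real.sin k := Real.sin_pos_of_mem_Ioo hk
  have hne₁ : Real.cos k ≠ -1 := fun h => by nlinarith [Real.sin_sq_add_cos_sq k]
  have hne₂ : Real.cos k ≠ 1 := fun h => by nlinarith [Real.sin_sq_add_cos_sq k]
  obtain ⟨C, hC, hb⟩ := (Real.hasDerivAt_arccos hne₁ hne₂).isBigO_sub.exists_pos
  obtain ⟨η, hη, h⟩ := Metric.eventually_nhds_iff.1 hb.bound
  refine ⟨C, hC, η, hη, fun y hy => ?_⟩
  simpa [Real.arccos_cos hk.1.le hk.2.le] using h (y := y) (by rwa [Real.dist_eq])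

/-- A large `z` lies at distance `|arccos (cos z) - k|` from some `2πn ± k`; this compares the
squares. -/
lemma exists_abs_sq_sub_sq_le {k z : ℝ} (hk : k ∈ Set.Ioo 0 Real.pi) (hz : 4 ≤ z) :
    ∃ n : ℕ, 1 ≤ n ∧
      (|z ^ 2 - (2 * Real.pi * n + k) ^ 2| ≤ |Real.arccos (Real.cos z) - k| * (3 * z) ∨
       |z ^ 2 - (2 * Real.pi * n - k) ^ 2| ≤ |Real.arccos (Real.cos z) - k| * (3 * z)) := by
  set t := Real.arccos (Real.cos z) with ht
  have ht0 : 0 ≤ t := Real.arccos_nonneg _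
  have htpi : t ≤ Real.pi := Real.arccos_le_pi _
  have hcos : Real.cos t = Real.cos z :=
    Real.cos_arccos (Real.neg_one_le_cos _) (Real.cos_le_one _)
  have hpi := Real.pi_lt_four
  have hpi0 := Real.pi_pos
  obtain ⟨hk0, hkpi⟩ := hk
  have sq_bound : ∀ w : ℝ, |z - w| = |t - k| →
      |z ^ 2 - w ^ 2| ≤ |t - k| * (3 * z) := by
    intro w hw
    have htk : |t - k| ≤ Real.pi := abs_le.2 ⟨by linarith, by linarith⟩
    rw [show z ^ 2 - w ^ 2 = (z - w) * (z + w) by ring, abs_mul, hw]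
    gcongr
    have := abs_le.1 (hw.le.trans htk)
    exact abs_le.2 ⟨by linarith, by linarith⟩
  obtain ⟨m, hm⟩ := Real.cos_eq_cos_iff.1 hcos
  have hm1 : 1 ≤ m := by
    by_contra hlt
    have hm0 : (m:ℝ) ≤ 0 := by exact_mod_cast (by omega : m ≤ 0)
    have : (m:ℝ) * Real.pi ≤ 0 := mul_nonpos_of_nonpos_of_nonneg hm0 hpi0.le
    rcases hm with h | h <;> linarith
  lift m to ℕ using by omega
  rw [Int.cast_natCast] at hm
  refine ⟨m, by exact_mod_cast hm1, ?_⟩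
  rcases hm with h | h
  · left
    refine sq_bound _ ?_
    rw [h]
    congr 1
    ring
  · right
    refine sq_bound _ ?_
    rw [h, ← abs_neg]
    congr 1
    ring

theorem quasi_periodic_eigenvalue_asymptotics
    (k : ℝ) (hk : k ∈ Set.Ioo 0 Real.pi)
    (a : ℝ) (V : ℝ → ℝ → ℝ)
    (hVint : ∀ lam : ℝ, a < lam → IntervalIntegrable (V lam) volume 0 1)
    (hnorm : Tendsto
      (fun lam : ℝ => (∫ s in (0:ℝ)..1, |V lam s|) / lam ^ ((1:ℝ)/4))
      atTop (nhds 0))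
    (havg : Tendsto (fun lam : ℝ => ∫ s in (0:ℝ)..1, V lam s) atTop (nhds 0))
    (θ φ φd : ℝ → ℝ → ℝ)
    (hθc : ∀ lam : ℝ, max a 0 < lam → ContinuousOn (θ lam) (Set.Icc (0:ℝ) 1))
    (hφc : ∀ lam : ℝ, max a 0 < lam → ContinuousOn (φ lam) (Set.Icc (0:ℝ) 1))
    (hθ : ∀ lam : ℝ, max a 0 < lam → ∀ x ∈ Set.Icc (0:ℝ) 1,
      θ lam x = Real.cos (Real.sqrt lam * x) +
        ∫ s in (0:ℝ)..x,
          (Real.sin (Real.sqrt lam * (x - s)) / Real.sqrt lam) * V lam s * θ lam s)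
    (hφ : ∀ lam : ℝ, max a 0 < lam → ∀ x ∈ Set.Icc (0:ℝ) 1,
      φ lam x = Real.sin (Real.sqrt lam * x) / Real.sqrt lam +
        ∫ s in (0:ℝ)..x,
          (Real.sin (Real.sqrt lam * (x - s)) / Real.sqrt lam) * V lam s * φ lam s)
    (hφd : ∀ lam : ℝ, max a 0 < lam → ∀ x ∈ Set.Icc (0:ℝ) 1,
      φd lam x = Real.cos (Real.sqrt lam * x) +
        ∫ s in (0:ℝ)..x, Real.cos (Real.sqrt lam * (x - s)) * V lam s * φ lam s) :
    ∀ ε > 0, ∃ Λ : ℝ, a < Λ ∧ ∀ lam : ℝ, Λ < lam →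
      (θ lam 1 + φd lam 1) / 2 = Real.cos k →
      ∃ n : ℕ, 1 ≤ n ∧
        (|lam - (2 * Real.pi * n + k) ^ 2| < ε ∨
         |lam - (2 * Real.pi * n - k) ^ 2| < ε) := by
  intro ε hε
  obtain ⟨C, hC, η, hη, harccos⟩ := exists_abs_arccos_sub_le hk
  obtain ⟨δ, hδ, hδm⟩ : ∃ δ : ℝ, 0 < δ ∧ δ < min 1 (min (η / 3) (ε / (9 * C))) :=
    exists_between (by positivity)
  obtain ⟨hδ1, hδη, hδε⟩ : δ < 1 ∧ δ < η / 3 ∧ δ < ε / (9 * C) := by simpa using hδm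
  have hev := (((hnorm.eventually_lt_const hδ).and
    (havg.abs.eventually_lt_const (by simpa using hδ))).and
    (eventually_gt_atTop (max a 0))).and (eventually_ge_atTop (16:ℝ))
  obtain ⟨Λ₀, hΛ₀⟩ := eventually_atTop.1 hev
  refine ⟨max Λ₀ (a + 1), (lt_add_one a).trans_le (le_max_right _ _), fun lam hlam hΔ => ?_⟩
  obtain ⟨⟨⟨hN, hA⟩, ha⟩, h16⟩ := hΛ₀ lam ((le_max_left _ _).trans hlam.le)
  have hV := hVint lam ((le_max_left _ _).trans_lt ha)
  have hlam0 : 0 < lam := by linarith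
  have hexp := abs_lyapunov_sub_le (V := V lam) (θ := θ lam) (φ := φ lam) (φd₁ := φd lam 1)
    (z := Real.sqrt lam) hV
  have hθ' := hθ lam ha
  have hφ' := hφ lam ha
  have hφd' := hφd lam ha 1 ⟨zero_le_one, le_rfl⟩
  rw [mul_one] at hφd'
  have hN0 : 0 ≤ ∫ s in (0:ℝ)..1, |V lam s| :=
    intervalIntegral.integral_nonneg zero_le_one fun s _ => abs_nonneg _
  have hroot : (lam ^ ((1:ℝ) / 4)) ^ 2 = Real.sqrt lam := by
    rw [Real.sqrt_eq_rpow, ← Real.rpow_natCast, ← Real.rpow_mul hlam0.le]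
    norm_num
  rw [div_lt_iff₀ (by positivity)] at hN
  have hzsq : Real.sqrt lam ^ 2 = lam := Real.sq_sqrt hlam0.le
  have hz4 : 4 ≤ Real.sqrt lam := Real.le_sqrt_of_sq_le (by linarith)
  set N := ∫ s in (0:ℝ)..1, |V lam s| with hNdef
  set A := ∫ s in (0:ℝ)..1, V lam s with hAdef
  set z := Real.sqrt lam with hz
  have hz0 : 0 < z := by linarith
  have hNsq : N ^ 2 ≤ δ ^ 2 * z := by
    rw [← hroot, ← mul_pow]
    gcongr
  have hδsq : δ ^ 2 ≤ δ := by nlinarith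
  have hNz : N ≤ z / 2 := by
    refine (sq_le_sq₀ hN0 (by positivity)).1 ?_
    nlinarith
  replace hexp := hexp hz0 hNz (hθc lam ha) (hφc lam ha) hθ' hφ' hφd'
  rw [hΔ] at hexp
  have hclose : |Real.cos z - Real.cos k| ≤ 3 * δ / z := by
    have h₁ : 2 * N ^ 2 / z ^ 2 ≤ 2 * δ / z := by
      rw [div_le_div_iff₀ (by positivity) hz0]
      nlinarith
    have h₂ : |Real.sin z / (2 * z) * A| ≤ δ / z := by
      rw [abs_mul, abs_div, abs_of_pos (by positivity : 0 < 2 * z)]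
      calc |Real.sin z| / (2 * z) * |A| ≤ 1 / (1 * z) * δ := by
            gcongr
            · exact Real.abs_sin_le_one _
            · norm_num
        _ = δ / z := by ring
    have h₃ := abs_le.1 (hexp.trans h₁)
    have h₄ := abs_le.1 h₂
    have h₅ : 3 * δ / z = 2 * δ / z + δ / z := by ring
    rw [h₅]
    exact abs_le.2 ⟨by linarith, by linarith⟩
  have hη' : |Real.cos z - Real.cos k| < η := by
    refine hclose.trans_lt ?_
    rw [div_lt_iff₀ hz0]
    nlinarith
  have hfinal : |Real.arccos (Real.cos z) - k| * (3 * z) < ε := by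
    calc |Real.arccos (Real.cos z) - k| * (3 * z) ≤ C * (3 * δ / z) * (3 * z) := by
          gcongr
          exact (harccos _ hη').trans (by gcongr)
      _ = δ * (9 * C) := by
          field_simp
          ring
      _ < ε := (lt_div_iff₀ (by positivity)).1 hδε
  obtain ⟨n, hn, h⟩ := exists_abs_sq_sub_sq_le hk hz4
  rw [hzsq] at h
  exact ⟨n, hn, h.imp (fun h => h.trans_lt hfinal) fun h => h.trans_lt hfinal⟩
end
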